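/- arXiv:1604.08779 — 4 statements merged into one kernel-verified Lean document; each statement's English description precedes it below -/
import Mathlib

section
/- It is undecidable whether the run of a given deterministic two-counter Minsky machine reaches a configuration in which both counters are zero. Formally: under a fixed effective encoding of deterministic two-counter Minsky machines as natural numbers, the set of codes of machines (Q,T) whose run visits some configuration in Q × {(0,0)} other than the initial configuration... is not a computable set (more precisely, for machines whose first transition increments a counter, the set of codes of machines whose run visits a configuration in Q × {(0,0)} after the initial configuration is not computable). -/
/-- A transition of a two-counter machine: `(source, counter index (0 or 1),
operation (0 = increment, 1 = decrement, 2 = zero-test), target)`. -/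
abbrev CMTrans : Type := ℕ × ℕ × ℕ × ℕ

/-- A two-counter Minsky machine: a finite list of transitions together with the
sink state `⊥`; the initial state is `0`. -/
abbrev TwoCM : Type := List CMTrans × ℕ

/-- The list of states of a machine (the initial state `0`, the sink, and all
states mentioned in transitions). -/
def cmStates (M : TwoCM) : List ℕ :=
  0 :: M.2 :: (M.1.map (fun t => t.1) ++ M.1.map (fun t => t.2.2.2))

/-- The outgoing transitions of a state. -/
def cmOutgoing (M : TwoCM) (s : ℕ) : List CMTrans := M.1.filter (fun t => t.1 = s)

/-- The machine is a deterministic two-counter Minsky machine: counter indices and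
operations are in range, the sink state has no outgoing transition, and every
other state has either exactly one outgoing transition, labelled by an increment,
or exactly two outgoing transitions, labelled by a decrement and a zero-test of
the same counter. -/
def CMDeterministic (M : TwoCM) : Prop :=
  (∀ t ∈ M.1, t.2.1 < 2 ∧ t.2.2.1 < 3) ∧
  cmOutgoing M M.2 = [] ∧
  ∀ s ∈ cmStates M, s ≠ M.2 →
    ((∃ i u, cmOutgoing M s = [(s, i, 0, u)]) ∨
     (∃ i u v, (cmOutgoing M s).Perm [(s, i, 1, u), (s, i, 2, v)]))

/-- The value of counter `i`. -/
def cmGet (i : ℕ) (c : ℕ × ℕ) : ℕ := if i = 0 then c.1 else c.2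

/-- Setting the value of counter `i`. -/
def cmSet (i : ℕ) (v : ℕ) (c : ℕ × ℕ) : ℕ × ℕ := if i = 0 then (v, c.2) else (c.1, v)

/-- Semantics of operation `op` (0 = increment, 1 = decrement, 2 = zero-test) on
counter `i`: a decrement is enabled only if the counter is positive, and the
zero-test only if the counter is zero. -/
def CMCounterSem (i op : ℕ) (c c' : ℕ × ℕ) : Prop :=
  (op = 0 ∧ c' = cmSet i (cmGet i c + 1) c) ∨
  (op = 1 ∧ 0 < cmGet i c ∧ c' = cmSet i (cmGet i c - 1) c) ∨
  (op = 2 ∧ cmGet i c = 0 ∧ c' = c)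

/-- One step of the machine on configurations `(state, counters)`. -/
def CMStep (M : TwoCM) (c c' : ℕ × ℕ × ℕ) : Prop :=
  ∃ i op, (c.1, i, op, c'.1) ∈ M.1 ∧ CMCounterSem i op c.2 c'.2

/-- The initial configuration `(s₀, (0, 0))`. -/
def cmInit : ℕ × ℕ × ℕ := (0, 0, 0)

/-- The first transition of the run increments a counter. -/
def CMFirstIncrements (M : TwoCM) : Prop := ∃ t ∈ M.1, t.1 = 0 ∧ t.2.2.1 = 0

/-- The run of the machine visits a configuration in `Q × {(0,0)}` after the
initial configuration. -/
def CMReachesZeroZero (M : TwoCM) : Prop :=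
  ∃ c₁ c, CMStep M cmInit c₁ ∧ Relation.ReflTransGen (CMStep M) c₁ c ∧ c.2 = (0, 0)

/-- The run of the machine reaches a configuration in `{⊥} × ℕ²`. -/
def CMReachesSink (M : TwoCM) : Prop :=
  ∃ c, Relation.ReflTransGen (CMStep M) cmInit c ∧ c.1 = M.2

/-- The fixed effective encoding of two-counter machines as natural numbers. -/
def encodeTwoCM (M : TwoCM) : ℕ := Encodable.encode M

/-- A machine step that does not lead to a configuration with both counters zero. -/
def GoodStep (M : TwoCM) (c c' : ℕ × ℕ × ℕ) : Prop := CMStep M c c' ∧ c'.2 ≠ (0, 0)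

/-- Reachability avoiding configurations with both counters zero. -/
abbrev Reach (M : TwoCM) : ℕ × ℕ × ℕ → ℕ × ℕ × ℕ → Prop := Relation.ReflTransGen (GoodStep M)

/-- The transitions `T` form a deterministic machine fragment with set of states `S`, all of
whose jumps lead to `S` or to the exits `X`. -/
structure WellFormed (T : List CMTrans) (S X : Set ℕ) : Prop where
  labels : ∀ t ∈ T, t.2.1 < 2 ∧ t.2.2.1 < 3
  source : ∀ t ∈ T, t.1 ∈ S
  target : ∀ t ∈ T, t.2.2.2 ∈ S ∪ X
  outgoing : ∀ s ∈ S, (∃ i u, T.filter (fun t => t.1 = s) = [(s, i, 0, u)]) ∨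
    ∃ i u v, (T.filter (fun t => t.1 = s)).Perm [(s, i, 1, u), (s, i, 2, v)]

theorem WellFormed.filter_eq_nil {T : List CMTrans} {S X : Set ℕ} (h : WellFormed T S X) {s : ℕ}
    (hs : s ∉ S) : T.filter (fun t => t.1 = s) = [] := by
  rw [List.filter_eq_nil_iff]
  intro t ht hts
  have := h.source t ht
  simp only [decide_eq_true_eq] at hts
  exact hs (hts ▸ this)

theorem WellFormed.mono {T : List CMTrans} {S X Y : Set ℕ} (h : WellFormed T S X)
    (hXY : X ⊆ S ∪ Y) : WellFormed T S Y :=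
  ⟨h.labels, h.source, fun t ht => (h.target t ht).elim Or.inl fun h => hXY h, h.outgoing⟩

theorem WellFormed.append {T₁ T₂ : List CMTrans} {S₁ S₂ X₁ X₂ X : Set ℕ}
    (h₁ : WellFormed T₁ S₁ X₁) (h₂ : WellFormed T₂ S₂ X₂) (hd : ∀ s ∈ S₁, s ∉ S₂)
    (hX₁ : X₁ ⊆ S₁ ∪ S₂ ∪ X) (hX₂ : X₂ ⊆ S₁ ∪ S₂ ∪ X) :
    WellFormed (T₁ ++ T₂) (S₁ ∪ S₂) X := by
  refine ⟨?_, ?_, ?_, ?_⟩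
  · intro t ht
    exact (List.mem_append.1 ht).elim (h₁.labels t) (h₂.labels t)
  · intro t ht
    exact (List.mem_append.1 ht).imp (h₁.source t) (h₂.source t)
  · intro t ht
    rcases List.mem_append.1 ht with ht | ht
    · exact (h₁.target t ht).elim (fun h => Or.inl (Or.inl h)) fun h => hX₁ h
    · exact (h₂.target t ht).elim (fun h => Or.inl (Or.inr h)) fun h => hX₂ h
  · intro s hs
    rw [List.filter_append]
    by_cases hs₁ : s ∈ S₁
    · rw [h₂.filter_eq_nil (hd s hs₁), List.append_nil]
      exact h₁.outgoing s hs₁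
    · rw [h₁.filter_eq_nil hs₁, List.nil_append]
      exact h₂.outgoing s (hs.resolve_left hs₁)

theorem WellFormed.deterministic {T : List CMTrans} {S : Set ℕ} {z : ℕ}
    (h : WellFormed T S {z}) (h0 : 0 ∈ S) (hz : z ∉ S) : CMDeterministic (T, z) := by
  refine ⟨h.labels, h.filter_eq_nil hz, fun s hs hsz => h.outgoing s ?_⟩
  simp only [cmStates, List.mem_cons, List.mem_append, List.mem_map] at hs
  rcases hs with rfl | rfl | ⟨t, ht, rfl⟩ | ⟨t, ht, rfl⟩
  · exact h0
  · exact absurd rfl hsz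
  · exact h.source t ht
  · exact (h.target t ht).resolve_right hsz

theorem wellFormed_inc (s i u : ℕ) (hi : i < 2) : WellFormed [(s, i, 0, u)] {s} {u} := by
  refine ⟨?_, ?_, ?_, ?_⟩ <;> simp
  omega

theorem wellFormed_dec (s i u v : ℕ) (hi : i < 2) :
    WellFormed [(s, i, 1, u), (s, i, 2, v)] {s} {u, v} := by
  refine ⟨?_, ?_, ?_, ?_⟩ <;> simp
  · omega
  · exact ⟨i, u, v, List.Perm.refl _⟩

/-- Some machine fragment with exits labelled by `ι`, placed at any position in any machine, takes
the counter values `c` to the values `c'` at exit `k` whenever `R c k c'` holds. -/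
def Impl {ι : Type} (R : ℕ × ℕ → ι → ℕ × ℕ → Prop) : Prop :=
  ∃ n, 0 < n ∧ ∀ (lo : ℕ) (x : ι → ℕ), ∃ T, WellFormed T (Set.Ico lo (lo + n)) (Set.range x) ∧
    ∀ M : TwoCM, T ⊆ M.1 → ∀ c k c', R c k c' → Reach M (lo, c) (x k, c')

theorem Impl.map {ι κ : Type} {R : ℕ × ℕ → ι → ℕ × ℕ → Prop} (h : Impl R) (f : ι → κ)
    {R' : ℕ × ℕ → κ → ℕ × ℕ → Prop} (hR : ∀ c k c', R' c k c' → ∃ i, f i = k ∧ R c i c') :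
    Impl R' := by
  obtain ⟨n, hn, h⟩ := h
  refine ⟨n, hn, fun lo x => ?_⟩
  obtain ⟨T, hT, hM⟩ := h lo (x ∘ f)
  refine ⟨T, hT.mono ?_, fun M hTM c k c' hc => ?_⟩
  · rintro _ ⟨i, rfl⟩
    exact Or.inr ⟨f i, rfl⟩
  · obtain ⟨i, rfl, hi⟩ := hR c k c' hc
    exact hM M hTM c i c' hi

theorem Impl.mono {ι : Type} {R R' : ℕ × ℕ → ι → ℕ × ℕ → Prop} (h : Impl R)
    (hR : ∀ c k c', R' c k c' → R c k c') : Impl R' :=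
  h.map id fun c k c' hc => ⟨k, rfl, hR c k c' hc⟩

/-- Continue at the exit `none` of the first fragment with the second fragment. -/
theorem Impl.orElse {κ : Type} {R : ℕ × ℕ → Option κ → ℕ × ℕ → Prop}
    {P : ℕ × ℕ → κ → ℕ × ℕ → Prop} (hR : Impl R) (hP : Impl P) :
    Impl fun c k c' => R c (some k) c' ∨ ∃ d, R c none d ∧ P d k c' := by
  obtain ⟨n₁, hn₁, h₁⟩ := hR
  obtain ⟨n₂, hn₂, h₂⟩ := hP
  refine ⟨n₁ + n₂, by omega, fun lo x => ?_⟩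
  obtain ⟨T₁, hT₁, hM₁⟩ := h₁ lo (fun o => o.elim (lo + n₁) x)
  obtain ⟨T₂, hT₂, hM₂⟩ := h₂ (lo + n₁) x
  have hS : Set.Ico lo (lo + (n₁ + n₂)) =
      Set.Ico lo (lo + n₁) ∪ Set.Ico (lo + n₁) (lo + n₁ + n₂) := by
    rw [Set.Ico_union_Ico_eq_Ico (by omega) (by omega), add_assoc]
  refine ⟨T₁ ++ T₂, ?_, fun M hTM c k c' hc => ?_⟩
  · rw [hS]
    refine hT₁.append hT₂ ?_ ?_ Set.subset_union_right
    · intro s hs hs'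
      simp only [Set.mem_Ico] at hs hs'
      omega
    · rintro _ ⟨_ | k, rfl⟩
      · exact Or.inl (Or.inr (by simp [hn₂]))
      · exact Or.inr ⟨k, rfl⟩
  · rw [List.append_subset] at hTM
    rcases hc with hc | ⟨d, hc, hd⟩
    · exact hM₁ M hTM.1 _ _ _ hc
    · exact (hM₁ M hTM.1 _ _ _ hc).trans (hM₂ M hTM.2 _ _ _ hd)

theorem Impl.seq {κ : Type} {R : ℕ × ℕ → Unit → ℕ × ℕ → Prop}
    {P : ℕ × ℕ → κ → ℕ × ℕ → Prop} (hR : Impl R) (hP : Impl P) :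
    Impl fun c k c' => ∃ d, R c () d ∧ P d k c' :=
  (Impl.orElse (R := fun c o c' => o = none ∧ R c () c')
    (hR.map (fun _ => none) fun _ _ _ h => ⟨(), h.1.symm, h.2⟩) hP).mono
    fun _ _ _ ⟨d, h₁, h₂⟩ => Or.inr ⟨d, ⟨rfl, h₁⟩, h₂⟩

theorem Impl.ite {κ : Type} {R : ℕ × ℕ → Bool → ℕ × ℕ → Prop}
    {P Q : ℕ × ℕ → κ → ℕ × ℕ → Prop} (hR : Impl R) (hP : Impl P) (hQ : Impl Q) :
    Impl fun c k c' => (∃ d, R c true d ∧ P d k c') ∨ ∃ d, R c false d ∧ Q d k c' := by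
  have h₁ : Impl fun c (o : Option (Option κ)) c' =>
      (o = none ∧ R c true c') ∨ (o = some none ∧ R c false c') :=
    hR.map (fun b => if b then none else some none) (by
      rintro c k c' (⟨rfl, h⟩ | ⟨rfl, h⟩)
      exacts [⟨true, rfl, h⟩, ⟨false, rfl, h⟩])
  have h₂ : Impl fun c (o : Option κ) c' => ∃ k, o = some k ∧ P c k c' :=
    hP.map some (by
      rintro c _ c' ⟨k, rfl, h⟩
      exact ⟨k, rfl, h⟩)
  refine ((h₁.orElse h₂).orElse hQ).mono ?_
  rintro c k c' (⟨d, hd, h⟩ | ⟨d, hd, h⟩)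
  · exact Or.inl (Or.inr ⟨d, Or.inl ⟨rfl, hd⟩, k, rfl, h⟩)
  · exact Or.inr ⟨d, Or.inl (Or.inr ⟨rfl, hd⟩), h⟩

/-- The relation computed by restarting a fragment at its exit `none`. -/
inductive Iter {κ : Type} (R : ℕ × ℕ → Option κ → ℕ × ℕ → Prop) : ℕ × ℕ → κ → ℕ × ℕ → Prop
  | leave {c k c'} : R c (some k) c' → Iter R c k c'
  | next {c d k c'} : R c none d → Iter R d k c' → Iter R c k c'

theorem Impl.iter {κ : Type} {R : ℕ × ℕ → Option κ → ℕ × ℕ → Prop} (hR : Impl R) :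
    Impl (Iter R) := by
  obtain ⟨n, hn, h⟩ := hR
  refine ⟨n, hn, fun lo x => ?_⟩
  obtain ⟨T, hT, hM⟩ := h lo (fun o => o.elim lo x)
  refine ⟨T, hT.mono ?_, fun M hTM c k c' hc => ?_⟩
  · rintro _ ⟨_ | k, rfl⟩
    · exact Or.inl (by simp [hn])
    · exact Or.inr ⟨k, rfl⟩
  · induction hc with
    | leave h => exact hM M hTM _ _ _ h
    | next h _ ih => exact (hM M hTM _ _ _ h).trans ih

theorem impl_inc (i : ℕ) (hi : i < 2) :
    Impl fun c (_ : Unit) c' => c' = cmSet i (cmGet i c + 1) c := by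
  refine ⟨1, one_pos, fun lo x => ⟨[(lo, i, 0, x ())], ?_, ?_⟩⟩
  · have h := (wellFormed_inc lo i (x ()) hi).mono (Y := Set.range x) (by simp)
    have hS : Set.Ico lo (lo + 1) = {lo} := by ext; simp; omega
    rwa [hS]
  · rintro M hM c k c' rfl
    refine Relation.ReflTransGen.single ⟨⟨i, 0, hM (by simp), Or.inl ⟨rfl, rfl⟩⟩, ?_⟩
    simp only [cmSet]
    split_ifs <;> simp [cmGet, *]

theorem impl_dec (i : ℕ) (hi : i < 2) :
    Impl fun c (b : Bool) c' => c' ≠ (0, 0) ∧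
      ((b = true ∧ 0 < cmGet i c ∧ c' = cmSet i (cmGet i c - 1) c) ∨
      (b = false ∧ cmGet i c = 0 ∧ c' = c)) := by
  refine ⟨1, one_pos, fun lo x => ⟨[(lo, i, 1, x true), (lo, i, 2, x false)], ?_, ?_⟩⟩
  · have h := (wellFormed_dec lo i (x true) (x false) hi).mono (Y := Set.range x) (by
      rintro _ (rfl | rfl) <;> simp)
    have hS : Set.Ico lo (lo + 1) = {lo} := by ext; simp; omega
    rwa [hS]
  · rintro M hM c k c' ⟨hne, ⟨rfl, h⟩ | ⟨rfl, h⟩⟩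
    · exact Relation.ReflTransGen.single
        ⟨⟨i, 1, hM (by simp), Or.inr (Or.inl ⟨rfl, h⟩)⟩, hne⟩
    · exact Relation.ReflTransGen.single
        ⟨⟨i, 2, hM (by simp), Or.inr (Or.inr ⟨rfl, h⟩)⟩, hne⟩

/-- The pair of counter values with counter `i` equal to `a` and the other one equal to `b`. -/
def counters (i a b : ℕ) : ℕ × ℕ := if i = 0 then (a, b) else (b, a)

theorem impl_add (i m : ℕ) (hi : i < 2) :
    Impl fun c (_ : Unit) c' => ∃ a b, c = counters i a b ∧ c' = counters i (a + (m + 1)) b := by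
  induction m with
  | zero =>
    refine (impl_inc i hi).mono ?_
    rintro _ _ _ ⟨a, b, rfl, rfl⟩
    interval_cases i <;> simp [counters, cmSet, cmGet]
  | succ m ih =>
    refine (ih.seq (impl_inc i hi)).mono ?_
    rintro _ _ _ ⟨a, b, rfl, rfl⟩
    refine ⟨_, ⟨a, b, rfl, rfl⟩, ?_⟩
    interval_cases i <;> simp [counters, cmSet, cmGet, add_assoc]

theorem impl_sub (i m : ℕ) (hi : i < 2) :
    Impl fun c (_ : Unit) c' => ∃ a b, 0 < a + b ∧
      c = counters i (a + (m + 1)) b ∧ c' = counters i a b := by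
  induction m with
  | zero =>
    refine (impl_dec i hi).map (fun _ => ()) ?_
    rintro _ _ _ ⟨a, b, hab, rfl, rfl⟩
    refine ⟨true, rfl, ?_⟩
    interval_cases i <;> simp [counters, cmSet, cmGet] <;> omega
  | succ m ih =>
    refine (ih.seq ((impl_dec i hi).map (fun _ => ()) (R' := fun c (_ : Unit) c' =>
      ∃ a b, 0 < a + b ∧ c = counters i (a + 1) b ∧ c' = counters i a b) ?_)).mono ?_
    · rintro _ _ _ ⟨a, b, hab, rfl, rfl⟩
      refine ⟨true, rfl, ?_⟩
      interval_cases i <;> simp [counters, cmSet, cmGet] <;> omega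
    · rintro _ _ _ ⟨a, b, hab, rfl, rfl⟩
      exact ⟨_, ⟨a + 1, b, by omega, by congr 1; omega, rfl⟩, a, b, hab, rfl, rfl⟩

theorem impl_skip : Impl fun c (_ : Unit) c' => c ≠ (0, 0) ∧ c' = c := by
  refine ((impl_add 1 0 (by norm_num)).seq (impl_sub 1 0 (by norm_num))).mono ?_
  rintro ⟨a, b⟩ _ _ ⟨h, rfl⟩
  refine ⟨_, ⟨b, a, rfl, rfl⟩, b, a, ?_, rfl, rfl⟩
  simp at h
  omega

/-- Transferring `m + 1` times the value of counter `i` to the other counter. -/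
theorem impl_transfer (i m : ℕ) (hi : i < 2) :
    Impl fun c (_ : Unit) c' => ∃ a b, (0 < b ∨ 1 < a) ∧
      c = counters i a b ∧ c' = counters i 0 (b + (m + 1) * a) := by
  have hadd : Impl fun c (o : Option Unit) c' => o = none ∧ ∃ a b,
      c = counters i a b ∧ c' = counters i a (b + (m + 1)) :=
    (impl_add (1 - i) m (by omega)).map (fun _ => none) (by
      rintro _ _ _ ⟨rfl, a, b, rfl, rfl⟩
      refine ⟨(), rfl, b, a, ?_⟩
      interval_cases i <;> simp [counters])
  have hskip : Impl fun c (o : Option Unit) c' => o = some () ∧ c ≠ (0, 0) ∧ c' = c :=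
    impl_skip.map some (by
      rintro _ _ _ ⟨rfl, h⟩
      exact ⟨(), rfl, h⟩)
  refine ((impl_dec i hi).ite hadd hskip).iter.mono ?_
  rintro _ _ _ ⟨a, b, hab, rfl, rfl⟩
  induction a generalizing b with
  | zero =>
    have hne : counters i 0 b ≠ (0, 0) := by
      interval_cases i <;> simp [counters] <;> omega
    refine Iter.leave (Or.inr ⟨counters i 0 b, ⟨hne, Or.inr ⟨rfl, ?_, rfl⟩⟩, rfl, hne, by simp⟩)
    interval_cases i <;> simp [counters, cmGet]
  | succ a ih =>
    have := ih (b + (m + 1)) (Or.inl (by omega))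
    rw [show b + (m + 1) + (m + 1) * a = b + (m + 1) * (a + 1) by ring] at this
    refine Iter.next (Or.inl ⟨counters i a b, ⟨?_, Or.inl ⟨rfl, ?_⟩⟩, rfl, a, b, rfl, rfl⟩) this
    · interval_cases i <;> simp [counters] <;> omega
    · interval_cases i <;> simp [counters, cmGet, cmSet]

theorem impl_moveBack :
    Impl fun c (_ : Unit) c' => ∃ x, 0 < x ∧ c = (0, x + 1) ∧ c' = (x, 1) := by
  refine ((impl_transfer 1 0 (by norm_num)).seq ((impl_add 1 0 (by norm_num)).seq
    (impl_sub 0 0 (by norm_num)))).mono ?_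
  rintro _ _ _ ⟨x, hx, rfl, rfl⟩
  refine ⟨(x + 1, 0), ⟨x + 1, 0, ?_⟩, (x + 1, 1), ⟨0, x + 1, ?_⟩, x, 1, ?_⟩ <;>
    simp [counters]
  omega

theorem impl_mul (p : ℕ) :
    Impl fun c (_ : Unit) c' => ∃ x, 0 < x ∧ c = (x, 1) ∧ c' = ((p + 1) * x, 1) := by
  refine ((impl_transfer 0 p (by norm_num)).seq impl_moveBack).mono ?_
  rintro _ _ _ ⟨x, hx, rfl, rfl⟩
  refine ⟨(0, (p + 1) * x + 1), ⟨x, 1, ?_⟩, (p + 1) * x, ?_⟩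
  · simp [counters, add_comm]
  · simp [hx]

theorem impl_restore (p j : ℕ) :
    Impl fun c (_ : Unit) c' => ∃ q, c = (0, q + 1) ∧ c' = ((p + 1) * q + (j + 1), 1) := by
  refine ((impl_add 0 j (by norm_num)).seq ((impl_transfer 1 p (by norm_num)).seq
    ((impl_add 1 0 (by norm_num)).seq (impl_sub 0 p (by norm_num))))).mono ?_
  rintro _ _ _ ⟨q, rfl, rfl⟩
  refine ⟨(j + 1, q + 1), ⟨0, q + 1, ?_⟩, ((p + 1) * q + (j + 1) + (p + 1), 0),
    ⟨q + 1, j + 1, ?_⟩, ((p + 1) * q + (j + 1) + (p + 1), 1), ⟨0, _, rfl, rfl⟩,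
    (p + 1) * q + (j + 1), 1, ?_⟩ <;> simp [counters]
  ring

/-- The specification of one round of a trial division by `p + 1`, after `p + 1 - m` of the
decrements of the round. -/
def DivRound (p m : ℕ) (c : ℕ × ℕ) (o : Option Bool) (c' : ℕ × ℕ) : Prop :=
  ∃ a q, c = (a, q + 1) ∧
    ((o = none ∧ m ≤ a ∧ c' = (a - m, q + 2)) ∨
    (o = some true ∧ a < m ∧ p + 1 - m + a = 0 ∧ 0 < q ∧ c' = (q, 1)) ∨
    (o = some false ∧ a < m ∧ p + 1 - m + a ≠ 0 ∧ c' = ((p + 1) * q + (p + 1 - m + a), 1)))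

theorem impl_divRound (p m : ℕ) (hm : m ≤ p + 1) : Impl (DivRound p m) := by
  induction m with
  | zero =>
    refine (impl_inc 1 (by norm_num)).map (fun _ => none) ?_
    rintro _ _ _ ⟨a, q, rfl, ⟨rfl, h⟩ | ⟨_, h, _⟩ | ⟨_, h, _⟩⟩
    · exact ⟨(), rfl, by simp [h, cmSet, cmGet]⟩
    · omega
    · omega
  | succ m ih =>
    have hfail : Impl fun c (o : Option Bool) c' => ∃ q, c = (0, q + 1) ∧
        ((o = some true ∧ p = m ∧ 0 < q ∧ c' = (q, 1)) ∨
        (o = some false ∧ p ≠ m ∧ c' = ((p + 1) * q + (p - m), 1))) := by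
      by_cases hpm : p = m
      · refine impl_moveBack.map (fun _ => some true) ?_
        rintro _ _ _ ⟨q, rfl, ⟨rfl, -, hq, rfl⟩ | ⟨-, h, -⟩⟩
        · exact ⟨(), rfl, q, hq, rfl, rfl⟩
        · exact absurd hpm h
      · refine (impl_restore p (p - m - 1)).map (fun _ => some false) ?_
        rintro _ _ _ ⟨q, rfl, ⟨-, h, -⟩ | ⟨rfl, -, rfl⟩⟩
        · exact absurd h hpm
        · refine ⟨(), rfl, q, rfl, ?_⟩
          rw [show p - m - 1 + 1 = p - m by omega]
    refine ((impl_dec 0 (by norm_num)).ite (ih (by omega)) hfail).mono ?_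
    rintro _ o _ ⟨a, q, rfl, h⟩
    rcases a with _ | a
    · refine Or.inr ⟨(0, q + 1), by simp [cmGet], q, rfl, ?_⟩
      rcases h with ⟨_, h, _⟩ | ⟨rfl, -, h, hq, rfl⟩ | ⟨rfl, -, h, rfl⟩
      · omega
      · exact Or.inl ⟨rfl, by omega, hq, rfl⟩
      · exact Or.inr ⟨rfl, by omega, by simp⟩
    · refine Or.inl ⟨(a, q + 1), by simp [cmGet, cmSet], a, q, rfl, ?_⟩
      have e : p + 1 - (m + 1) + (a + 1) = p + 1 - m + a := by omega
      rw [e] at h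
      simpa using h

theorem impl_div (p : ℕ) :
    Impl fun c (b : Bool) c' => ∃ N, 0 < N ∧ c = (N, 1) ∧
      ((b = true ∧ p + 1 ∣ N ∧ c' = (N / (p + 1), 1)) ∨
      (b = false ∧ ¬ p + 1 ∣ N ∧ c' = (N, 1))) := by
  refine (impl_divRound p (p + 1) le_rfl).iter.mono ?_
  rintro _ b _ ⟨N, hN, rfl, h⟩
  suffices H : ∀ a q, N = a + (p + 1) * q → ∀ c',
      ((b = true ∧ p + 1 ∣ N ∧ c' = (N / (p + 1), 1)) ∨
      (b = false ∧ ¬ p + 1 ∣ N ∧ c' = (N, 1))) →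
      Iter (DivRound p (p + 1)) (a, q + 1) b c' from H N 0 (by simp) _ h
  clear h
  intro a
  induction a using Nat.strong_induction_on with
  | _ a ih =>
    intro q hq c' h
    by_cases ha : p + 1 ≤ a
    · refine Iter.next (d := (a - (p + 1), q + 2)) ⟨a, q, rfl, Or.inl ⟨rfl, ha, rfl⟩⟩ ?_
      refine ih _ (by omega) (q + 1) ?_ c' h
      rw [mul_add, hq]
      omega
    · refine Iter.leave ⟨a, q, rfl, Or.inr ?_⟩
      have hdvd : p + 1 ∣ N ↔ a = 0 := by
        rw [hq, Nat.dvd_add_left (dvd_mul_right _ _)]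
        exact ⟨fun h => Nat.eq_zero_of_dvd_of_lt h (by omega), fun h => h ▸ dvd_zero _⟩
      rcases h with ⟨rfl, h, rfl⟩ | ⟨rfl, h, rfl⟩
      · obtain rfl := hdvd.1 h
        have : 0 < q := by
          rcases Nat.eq_zero_or_pos q with rfl | h
          · simp at hq; omega
          · exact h
        exact Or.inl ⟨rfl, by omega, by omega, this, by simp [hq]⟩
      · rw [hdvd] at h
        exact Or.inr ⟨rfl, by omega, by omega, by simp [hq, add_comm]⟩

/-- Programs over registers indexed by `ℕ`; `loop r p` decrements `r` and runs `p` as long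
as register `r` is positive. -/
inductive RegProg
  | skip
  | inc (r : ℕ)
  | seq (p q : RegProg)
  | loop (r : ℕ) (p : RegProg)

namespace RegProg

/-- Big-step semantics. -/
inductive Run : RegProg → (ℕ → ℕ) → (ℕ → ℕ) → Prop
  | skip (s) : Run skip s s
  | inc (r s) : Run (inc r) s (Function.update s r (s r + 1))
  | seq {p q s t u} : Run p s t → Run q t u → Run (seq p q) s u
  | done {r p s} : s r = 0 → Run (loop r p) s s
  | step {r p s t u} : 0 < s r → Run p (Function.update s r (s r - 1)) t →
      Run (loop r p) t u → Run (loop r p) s u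

theorem Run.of_eq {p : RegProg} {s t u : ℕ → ℕ} (h : Run p s t) (htu : t = u) : Run p s u :=
  htu ▸ h

/-- All registers used by the program are smaller than `k`. -/
def UsesBelow (k : ℕ) : RegProg → Prop
  | skip => True
  | inc r => r < k
  | seq p q => UsesBelow k p ∧ UsesBelow k q
  | loop r p => r < k ∧ UsesBelow k p

theorem UsesBelow.mono {k l : ℕ} (h : k ≤ l) {p : RegProg} (hp : UsesBelow k p) :
    UsesBelow l p := by
  induction p with
  | skip => trivial
  | inc r => exact lt_of_lt_of_le hp h
  | seq p q ihp ihq => exact ⟨ihp hp.1, ihq hp.2⟩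
  | loop r p ih => exact ⟨lt_of_lt_of_le hp.1 h, ih hp.2⟩

theorem exists_usesBelow (p : RegProg) : ∃ k, UsesBelow k p := by
  induction p with
  | skip => exact ⟨0, trivial⟩
  | inc r => exact ⟨r + 1, Nat.lt_succ_self r⟩
  | seq p q ihp ihq =>
    obtain ⟨k, hk⟩ := ihp
    obtain ⟨l, hl⟩ := ihq
    exact ⟨max k l, hk.mono (le_max_left _ _), hl.mono (le_max_right _ _)⟩
  | loop r p ih =>
    obtain ⟨k, hk⟩ := ih
    exact ⟨max (r + 1) k, lt_of_lt_of_le (Nat.lt_succ_self r) (le_max_left _ _),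
      hk.mono (le_max_right _ _)⟩

/-- Gödel encoding of the first `k` registers by prime powers. -/
noncomputable def godel (k : ℕ) (s : ℕ → ℕ) : ℕ :=
  ∏ i ∈ Finset.range k, Nat.nth Nat.Prime i ^ s i

theorem godel_pos (k : ℕ) (s : ℕ → ℕ) : 0 < godel k s :=
  Finset.prod_pos fun i _ => pow_pos (Nat.prime_nth_prime i).pos _

theorem godel_update {k r : ℕ} (hr : r < k) (s : ℕ → ℕ) (v : ℕ) :
    godel k (Function.update s r v) = Nat.nth Nat.Prime r ^ v *
      ∏ i ∈ (Finset.range k).erase r, Nat.nth Nat.Prime i ^ s i := by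
  rw [godel, ← Finset.mul_prod_erase _ _ (Finset.mem_range.2 hr), Function.update_self]
  congr 1
  refine Finset.prod_congr rfl fun i hi => ?_
  rw [Function.update_of_ne (Finset.ne_of_mem_erase hi)]

theorem godel_update_succ {k r : ℕ} (hr : r < k) (s : ℕ → ℕ) (v : ℕ) :
    godel k (Function.update s r (v + 1)) =
      Nat.nth Nat.Prime r * godel k (Function.update s r v) := by
  rw [godel_update hr, godel_update hr, pow_succ]
  ring

theorem dvd_godel {k r : ℕ} (hr : r < k) (s : ℕ → ℕ) :
    Nat.nth Nat.Prime r ∣ godel k s ↔ 0 < s r := by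
  constructor
  · intro h
    obtain ⟨i, -, hi⟩ := (Nat.prime_nth_prime r).prime.exists_mem_finset_dvd h
    have h₁ := (Nat.prime_nth_prime r).dvd_of_dvd_pow hi
    rw [Nat.prime_dvd_prime_iff_eq (Nat.prime_nth_prime r) (Nat.prime_nth_prime i)] at h₁
    obtain rfl := Nat.nth_injective Nat.infinite_setOfPred_prime h₁
    by_contra h₀
    rw [Nat.eq_zero_of_not_pos h₀, pow_zero] at hi
    exact (Nat.prime_nth_prime r).one_lt.ne' (Nat.dvd_one.1 hi)
  · intro h
    exact (dvd_pow_self _ h.ne').trans (Finset.dvd_prod_of_mem _ (Finset.mem_range.2 hr))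

/-- Register programs can be simulated on two counters. -/
theorem impl {k : ℕ} {p : RegProg} (hp : UsesBelow k p) :
    Impl fun c (_ : Unit) c' => ∃ s t, Run p s t ∧ c = (godel k s, 1) ∧ c' = (godel k t, 1) := by
  induction p with
  | skip =>
    refine impl_skip.mono ?_
    rintro _ _ _ ⟨s, t, h, rfl, rfl⟩
    cases h
    simp
  | inc r =>
    obtain ⟨m, hm⟩ := Nat.exists_eq_succ_of_ne_zero (Nat.prime_nth_prime r).ne_zero
    refine (impl_mul m).mono ?_
    rintro _ _ _ ⟨s, t, h, rfl, rfl⟩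
    cases h
    refine ⟨_, godel_pos k s, rfl, ?_⟩
    rw [godel_update_succ hp, hm, Function.update_eq_self]
  | seq p q ihp ihq =>
    refine ((ihp hp.1).seq (ihq hp.2)).mono ?_
    rintro _ _ _ ⟨s, t, h, rfl, rfl⟩
    cases h with
    | seq h₁ h₂ => exact ⟨_, ⟨_, _, h₁, rfl, rfl⟩, _, _, h₂, rfl, rfl⟩
  | loop r p ih =>
    obtain ⟨m, hm⟩ := Nat.exists_eq_succ_of_ne_zero (Nat.prime_nth_prime r).ne_zero
    have hbody : Impl fun c (o : Option Unit) c' => o = none ∧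
        ∃ s t, Run p s t ∧ c = (godel k s, 1) ∧ c' = (godel k t, 1) :=
      (ih hp.2).map (fun _ => none) fun _ _ _ h => ⟨(), h.1.symm, h.2⟩
    have hskip : Impl fun c (o : Option Unit) c' => o = some () ∧ c ≠ (0, 0) ∧ c' = c :=
      impl_skip.map some fun _ _ _ h => ⟨(), h.1.symm, h.2⟩
    refine ((impl_div m).ite hbody hskip).iter.mono ?_
    rintro _ _ _ ⟨s, t, h, rfl, rfl⟩
    generalize hq : loop r p = q at h
    induction h with
    | skip | inc | seq => simp at hq
    | @done r' p' s h =>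
      obtain ⟨rfl, rfl⟩ := RegProg.loop.inj hq
      refine Iter.leave (Or.inr ⟨(godel k s, 1), ⟨_, godel_pos k s, rfl, Or.inr ⟨rfl, ?_, rfl⟩⟩,
        rfl, by simp, rfl⟩)
      rw [← Nat.succ_eq_add_one, ← hm, dvd_godel hp.1]
      omega
    | @step r' p' s t u h h₁ _ _ ih₂ =>
      obtain ⟨rfl, rfl⟩ := RegProg.loop.inj hq
      refine Iter.next (d := (godel k t, 1)) (Or.inl ⟨_, ⟨_, godel_pos k s, rfl,
        Or.inl ⟨rfl, ?_, ?_⟩⟩, rfl, _, _, h₁, rfl, rfl⟩) (ih₂ rfl)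
      · rw [← Nat.succ_eq_add_one, ← hm]
        exact (dvd_godel hp.1 s).2 h
      · have := godel_update_succ hp.1 s (s r - 1)
        rw [Nat.sub_add_cancel h, Function.update_eq_self] at this
        rw [← Nat.succ_eq_add_one, ← hm, this,
          Nat.mul_div_cancel_left _ (Nat.prime_nth_prime r).pos]

/-- Set register `r` to zero. -/
def clear (r : ℕ) : RegProg := loop r skip

theorem run_clear (r : ℕ) (s : ℕ → ℕ) : Run (clear r) s (Function.update s r 0) := by
  generalize hn : s r = n
  induction n generalizing s with
  | zero =>
    rw [← hn, Function.update_eq_self]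
    exact Run.done hn
  | succ n ih =>
    have := ih (Function.update s r n) (by simp)
    rw [Function.update_idem] at this
    exact Run.step (by omega) (by rw [hn]; exact Run.skip _) this

/-- Move the content of register `a` to the registers `b` and `c`. -/
def move₂ (a b c : ℕ) : RegProg := loop a (seq (inc b) (inc c))

theorem run_move₂ {a b c : ℕ} (hab : a ≠ b) (hac : a ≠ c) (hbc : b ≠ c) (s : ℕ → ℕ) :
    Run (move₂ a b c) s (Function.update (Function.update (Function.update s a 0)
      b (s b + s a)) c (s c + s a)) := by
  generalize hn : s a = n
  induction n generalizing s with
  | zero =>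
    refine (Run.done hn).of_eq (funext fun k => ?_)
    simp only [Function.update_apply]
    split_ifs <;> simp_all
  | succ n ih =>
    refine Run.step (by omega) (Run.seq (Run.inc _ _) (Run.inc _ _)) ?_
    refine (ih _ ?_).of_eq (funext fun k => ?_)
    · simp [Function.update_apply, hab, hac, hn]
    · simp only [Function.update_apply]
      split_ifs <;> simp_all <;> omega

/-- Move the content of register `a` to register `b`. -/
def move (a b : ℕ) : RegProg := loop a (inc b)

theorem run_move {a b : ℕ} (hab : a ≠ b) (s : ℕ → ℕ) :
    Run (move a b) s (Function.update (Function.update s a 0) b (s b + s a)) := by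
  generalize hn : s a = n
  induction n generalizing s with
  | zero =>
    refine (Run.done hn).of_eq (funext fun k => ?_)
    simp only [Function.update_apply]
    split_ifs <;> simp_all
  | succ n ih =>
    refine Run.step (by omega) (Run.inc _ _) ?_
    refine (ih _ ?_).of_eq (funext fun k => ?_)
    · simp [Function.update_apply, hab, hn]
    · simp only [Function.update_apply]
      split_ifs <;> simp_all
      omega

/-- Copy register `a` to register `b`, using the scratch register `c`. -/
def copy (a b c : ℕ) : RegProg := seq (move₂ a b c) (move c a)

theorem run_copy {a b c : ℕ} (hab : a ≠ b) (hac : a ≠ c) (hbc : b ≠ c) (s : ℕ → ℕ)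
    (hb : s b = 0) (hc : s c = 0) : Run (copy a b c) s (Function.update s b (s a)) := by
  refine Run.seq (run_move₂ hab hac hbc s) ?_
  refine (run_move hac.symm _).of_eq (funext fun k => ?_)
  simp only [Function.update_apply]
  split_ifs <;> simp_all

theorem exists_clear_range (b m : ℕ) :
    ∃ p, ∀ s, Run p s fun k => if b ≤ k ∧ k < b + m then 0 else s k := by
  induction m with
  | zero =>
    exact ⟨skip, fun s => (Run.skip s).of_eq (funext fun k => by rw [if_neg (by omega)])⟩
  | succ m ih =>
    obtain ⟨p, hp⟩ := ih
    refine ⟨seq p (clear (b + m)), fun s => (Run.seq (hp s) (run_clear _ _)).of_eq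
      (funext fun k => ?_)⟩
    simp only [Function.update_apply]
    split_ifs <;> first | rfl | omega

/-- `f` can be computed by a register program, for any choice of input registers `a`, output
register `o` and first scratch register `b`. -/
def Compiles {n : ℕ} (f : List.Vector ℕ n →. ℕ) : Prop :=
  ∀ (a : Fin n → ℕ) (o b : ℕ), (∀ i, a i < b) → (∀ i, a i ≠ o) → o < b →
    ∃ p, ∀ (s : ℕ → ℕ) (v : List.Vector ℕ n) (y : ℕ), (∀ i, s (a i) = v.get i) → s o = 0 →
      (∀ k, b ≤ k → s k = 0) → y ∈ f v → Run p s (Function.update s o y)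

theorem exists_compute_all {n m : ℕ} {g : Fin m → List.Vector ℕ n →. ℕ}
    (hg : ∀ i, Compiles (g i)) (a : Fin n → ℕ) (b : ℕ) (ha : ∀ i, a i < b) (j : ℕ) (hj : j ≤ m) :
    ∃ p, ∀ (s : ℕ → ℕ) (v : List.Vector ℕ n) (w : ℕ → ℕ), (∀ i, s (a i) = v.get i) →
      (∀ k, b ≤ k → s k = 0) → (∀ i : Fin m, w i ∈ g i v) →
      Run p s fun k => if b ≤ k ∧ k < b + j then w (k - b) else s k := by
  induction j with
  | zero =>
    exact ⟨skip, fun s _ _ _ _ _ =>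
      (Run.skip s).of_eq (funext fun k => by rw [if_neg (by omega)])⟩
  | succ j ih =>
    obtain ⟨p, hp⟩ := ih (by omega)
    obtain ⟨q, hq⟩ := hg ⟨j, hj⟩ a (b + j) (b + m) (fun i => by have := ha i; omega)
      (fun i => by have := ha i; omega) (by omega)
    refine ⟨seq p q, fun s v w hs h0 hw => (Run.seq (hp s v w hs h0 hw)
      (hq _ v (w j) ?_ ?_ ?_ (hw ⟨j, hj⟩))).of_eq (funext fun k => ?_)⟩
    · intro i
      have := ha i
      rw [if_neg (by omega), hs]
    · rw [if_neg (by omega), h0 _ (by omega)]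
    · intro k hk
      rw [if_neg (by omega), h0 _ (by omega)]
    · simp only [Function.update_apply]
      by_cases hk : k = b + j
      · subst hk
        simp
      · rw [if_neg hk]
        congr 1
        simp only [eq_iff_iff]
        omega

theorem Compiles.comp {n m : ℕ} {f : List.Vector ℕ m →. ℕ} {g : Fin m → List.Vector ℕ n →. ℕ}
    (hf : Compiles f) (hg : ∀ i, Compiles (g i)) {F : List.Vector ℕ n →. ℕ}
    (hF : ∀ v, ∀ y ∈ F v, ∃ w : List.Vector ℕ m, (∀ i, w.get i ∈ g i v) ∧ y ∈ f w) :
    Compiles F := by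
  intro a o b ha hao hob
  obtain ⟨p, hp⟩ := exists_compute_all hg a b ha m le_rfl
  obtain ⟨q, hq⟩ := hf (fun i => b + i) o (b + m) (fun i => by omega) (fun i => by omega)
    (by omega)
  obtain ⟨r, hr⟩ := exists_clear_range b m
  refine ⟨seq p (seq q r), fun s v y hs ho h0 hy => ?_⟩
  obtain ⟨w, hw, hyw⟩ := hF v y hy
  refine (Run.seq (hp s v (fun i => if h : i < m then w.get ⟨i, h⟩ else 0) hs h0 ?_)
    (Run.seq (hq _ w y ?_ ?_ ?_ hyw) (hr _))).of_eq (funext fun k => ?_)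
  · intro i
    simpa using hw i
  · intro i
    simp
  · rw [if_neg (by omega), ho]
  · intro k hk
    rw [if_neg (by omega), h0 _ (by omega)]
  · simp only [Function.update_apply]
    split_ifs with h₁ h₂
    · omega
    · exact (h0 _ h₁.1).symm
    · rfl
    · rfl

theorem Compiles.prec {n : ℕ} {f : List.Vector ℕ n → ℕ} {g : List.Vector ℕ (n + 2) → ℕ}
    (hf : Compiles (fun v => Part.some (f v))) (hg : Compiles (fun v => Part.some (g v))) :
    Compiles (fun v : List.Vector ℕ (n + 1) => Part.some
      (Nat.rec (f v.tail) (fun y IH => g (y ::ᵥ IH ::ᵥ v.tail)) v.head : ℕ)) := by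
  intro a o b ha hao hob
  obtain ⟨p, hp⟩ := hf (fun i => a i.succ) o (b + 3) (fun i => by have := ha i.succ; omega)
    (fun i => hao _) (by omega)
  obtain ⟨q, hq⟩ := hg (Fin.cons (b + 1) (Fin.cons o fun i => a i.succ)) (b + 2) (b + 3)
    (by
      refine Fin.cases (by simp) (Fin.cases ?_ fun i => ?_)
      · simp; omega
      · have := ha i.succ
        simp; omega)
    (by
      refine Fin.cases (by simp) (Fin.cases ?_ fun i => ?_)
      · simp; omega
      · have := ha i.succ
        simp; omega)
    (by omega)
  refine ⟨seq (copy (a 0) b (b + 1)) (seq p (seq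
    (loop b (seq q (seq (clear o) (seq (move (b + 2) o) (inc (b + 1)))))) (clear (b + 1)))),
    fun s v y hs ho h0 hy => ?_⟩
  obtain rfl := Part.mem_some_iff.1 hy
  have h00 := h0 b le_rfl
  have h01 := h0 (b + 1) (by omega)
  have h02 := h0 (b + 2) (by omega)
  have ha0 := ha 0
  have htail : ∀ i : Fin n, s (a i.succ) = v.tail.get i := fun i => by
    rw [hs, List.Vector.get_tail_succ]
  set R : ℕ → ℕ := fun m => Nat.rec (f v.tail) (fun y IH => g (y ::ᵥ IH ::ᵥ v.tail)) m with hR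
  set st : ℕ → ℕ → ℕ → ℕ → ℕ := fun j m x =>
    Function.update (Function.update (Function.update s b j) (b + 1) m) o x with hst
  have st_apply : ∀ j m x k,
      st j m x k = if k = o then x else if k = b + 1 then m else if k = b then j else s k :=
    fun j m x k => by simp only [hst, Function.update_apply]
  have st_input : ∀ j m x (i : Fin n), st j m x (a i.succ) = v.tail.get i := fun j m x i => by
    have := ha i.succ
    rw [st_apply, if_neg (hao _), if_neg (by omega), if_neg (by omega), htail]
  have st_scratch : ∀ j m x k, b + 2 ≤ k → st j m x k = 0 := fun j m x k hk => by
    rw [st_apply, if_neg (by omega), if_neg (by omega), if_neg (by omega), h0 k (by omega)]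
  have hbody : ∀ j m, Run (seq q (seq (clear o) (seq (move (b + 2) o) (inc (b + 1)))))
      (st j m (R m)) (st j (m + 1) (R (m + 1))) := by
    intro j m
    refine (Run.seq (hq _ (m ::ᵥ R m ::ᵥ v.tail) (R (m + 1)) ?_ ?_ ?_ (Part.mem_some _))
      (Run.seq (run_clear _ _) (Run.seq (run_move (by omega) _) (Run.inc _ _)))).of_eq
      (funext fun k => ?_)
    · refine Fin.cases ?_ (Fin.cases ?_ fun i => ?_)
      · simp [st_apply]
        omega
      · simp [st_apply]
        rfl
      · simpa using st_input j m (R m) i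
    · exact st_scratch _ _ _ _ le_rfl
    · exact fun k hk => st_scratch _ _ _ _ (by omega)
    · simp only [Function.update_apply, st_apply]
      grind
  have hloop : ∀ j m, Run (loop b (seq q (seq (clear o) (seq (move (b + 2) o) (inc (b + 1))))))
      (st j m (R m)) (st 0 (m + j) (R (m + j))) := by
    intro j
    induction j with
    | zero =>
      intro m
      exact Run.done (by rw [st_apply]; grind)
    | succ j ih =>
      intro m
      have hb := st_apply (j + 1) m (R m) b
      rw [if_neg (by omega), if_neg (by omega), if_pos rfl] at hb
      have e : Function.update (st (j + 1) m (R m)) b (st (j + 1) m (R m) b - 1) =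
          st j m (R m) := by
        funext k
        simp only [Function.update_apply, st_apply]
        grind
      refine (Run.step (by omega) (e ▸ hbody j m) (ih (m + 1))).of_eq ?_
      rw [show m + 1 + j = m + (j + 1) by omega]
  have hcopy : Run (copy (a 0) b (b + 1)) s (st v.head 0 0) := by
    refine (run_copy (by omega) (by omega) (by omega) s h00 h01).of_eq (funext fun k => ?_)
    rw [hs 0, List.Vector.get_zero]
    simp only [Function.update_apply, st_apply]
    grind
  have hinit : Run p (st v.head 0 0) (st v.head 0 (R 0)) := by
    refine (hp _ v.tail (R 0) (st_input _ _ _) ?_ (fun k hk => st_scratch _ _ _ _ (by omega))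
      (Part.mem_some _)).of_eq (funext fun k => ?_)
    · simp [st_apply]
    · simp only [Function.update_apply, st_apply]
      grind
  refine (Run.seq hcopy (Run.seq hinit (Run.seq (hloop v.head 0) (run_clear _ _)))).of_eq
    (funext fun k => ?_)
  rw [Nat.zero_add]
  simp only [Function.update_apply, st_apply]
  grind

theorem compiles_get {n : ℕ} (i : Fin n) :
    Compiles (fun v : List.Vector ℕ n => Part.some (v.get i)) := by
  intro a o b ha hao hob
  have := ha i
  refine ⟨copy (a i) o b, fun s v y hs ho h0 hy => ?_⟩
  obtain rfl := Part.mem_some_iff.1 hy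
  rw [← hs]
  exact run_copy (hao i) (by omega) (by omega) s ho (h0 b le_rfl)

theorem Compiles.rfind {n : ℕ} {f : List.Vector ℕ (n + 1) → ℕ}
    (hf : Compiles (fun v => Part.some (f v))) :
    Compiles (fun v : List.Vector ℕ n =>
      Nat.rfind fun m => Part.some (decide (f (m ::ᵥ v) = 0))) := by
  intro a o b ha hao hob
  obtain ⟨p, hp⟩ := hf (Fin.cons o a) b (b + 1)
    (by
      refine Fin.cases (by simp; omega) fun i => ?_
      have := ha i
      simp; omega)
    (by
      refine Fin.cases (by simp; omega) fun i => ?_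
      have := ha i
      simp; omega)
    (by omega)
  refine ⟨seq p (loop b (seq (clear b) (seq (inc o) p))), fun s v y hs ho h0 hy => ?_⟩
  obtain ⟨hy, hlt⟩ := Nat.mem_rfind.1 hy
  replace hy : f (y ::ᵥ v) = 0 := by simpa using hy
  replace hlt : ∀ m < y, f (m ::ᵥ v) ≠ 0 := fun m hm => by simpa using hlt hm
  have hp' : ∀ m, Run p (Function.update s o m)
      (Function.update (Function.update s o m) b (f (m ::ᵥ v))) := by
    intro m
    refine hp _ (m ::ᵥ v) _ ?_ ?_ ?_ (Part.mem_some _)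
    · refine Fin.cases (by simp) fun i => ?_
      simp [Function.update_of_ne (hao i), hs i]
    · rw [Function.update_of_ne (by omega), h0 b le_rfl]
    · intro k hk
      rw [Function.update_of_ne (by omega), h0 k (by omega)]
  have hloop : ∀ j m, m + j = y → Run (loop b (seq (clear b) (seq (inc o) p)))
      (Function.update (Function.update s o m) b (f (m ::ᵥ v))) (Function.update s o y) := by
    intro j
    induction j with
    | zero =>
      rintro m rfl
      refine (Run.done ?_).of_eq ?_
      · simpa using hy
      · rw [Nat.add_zero] at hy ⊢
        rw [hy, Function.update_eq_self_iff, Function.update_of_ne (by omega), h0 b le_rfl]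
    | succ j ih =>
      intro m hm
      have hpos := hlt m (by omega)
      refine Run.step (by simp; omega) (Run.seq (run_clear _ _) (Run.seq (Run.inc _ _) ?_))
        (ih (m + 1) (by omega))
      convert hp' (m + 1) using 1
      funext k
      have := h0 b le_rfl
      simp only [Function.update_apply]
      grind
  have := hp' 0
  rw [show Function.update s o 0 = s by rw [← ho, Function.update_eq_self]] at this
  refine Run.seq this ?_
  have := hloop y 0 (by omega)
  rwa [show Function.update s o 0 = s by rw [← ho, Function.update_eq_self]] at this

theorem compiles_of_primrec' {n : ℕ} {f : List.Vector ℕ n → ℕ} (hf : Nat.Primrec' f) :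
    Compiles (fun v => Part.some (f v)) := by
  induction hf with
  | zero =>
    intro a o b ha hao hob
    refine ⟨skip, fun s v y hs ho h0 hy => ?_⟩
    obtain rfl := Part.mem_some_iff.1 hy
    exact (Run.skip s).of_eq (Function.eq_update_iff.2 ⟨ho, fun _ _ => rfl⟩)
  | succ =>
    intro a o b ha hao hob
    obtain ⟨p, hp⟩ := compiles_get (0 : Fin 1) a o b ha hao hob
    refine ⟨seq p (inc o), fun s v y hs ho h0 hy => ?_⟩
    obtain rfl := Part.mem_some_iff.1 hy
    refine (Run.seq (hp s v _ hs ho h0 (Part.mem_some _)) (Run.inc _ _)).of_eq ?_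
    simp
  | get i => exact compiles_get i
  | comp g _ _ ihf ihg =>
    refine ihf.comp ihg fun v y hy => ⟨_, fun i => ?_, hy⟩
    simp
  | prec _ _ ihf ihg => exact ihf.prec ihg

theorem get_mem_of_mem_mOfFn {n : ℕ} {g : Fin n → Part ℕ} {w : List.Vector ℕ n}
    (hw : w ∈ List.Vector.mOfFn g) (i : Fin n) : w.get i ∈ g i := by
  induction n with
  | zero => exact i.elim0
  | succ n ih =>
    simp only [List.Vector.mOfFn, Part.bind_eq_bind, Part.mem_bind_iff, Part.pure_eq_some,
      Part.mem_some_iff] at hw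
    obtain ⟨x, hx, u, hu, rfl⟩ := hw
    refine Fin.cases ?_ (fun i => ?_) i
    · simpa using hx
    · simpa using ih hu i

theorem compiles_of_partrec' {n : ℕ} {f : List.Vector ℕ n →. ℕ} (hf : Nat.Partrec' f) :
    Compiles f := by
  induction hf with
  | prim hf => exact compiles_of_primrec' hf
  | comp g _ _ ihf ihg =>
    refine ihf.comp ihg fun v y hy => ?_
    obtain ⟨w, hw, hy⟩ := Part.mem_bind_iff.1 hy
    exact ⟨w, get_mem_of_mem_mOfFn hw, hy⟩
  | rfind _ ih => exact ih.rfind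

theorem exists_run_of_partrec {f : ℕ →. ℕ} (hf : Partrec f) :
    ∃ p, ∀ n, ∀ y ∈ f n, Run p (Function.update 0 0 n) (Function.update 0 1 y) := by
  obtain ⟨p, hp⟩ := compiles_of_partrec' (Nat.Partrec'.part_iff₁.2 hf) (fun _ => 0) 1 2
    (by simp) (by simp) (by norm_num)
  refine ⟨seq p (clear 0), fun n y hy => (Run.seq (hp _ (n ::ᵥ List.Vector.nil) y ?_ ?_ ?_ ?_)
    (run_clear _ _)).of_eq (funext fun k => ?_)⟩
  · intro i
    simp [Subsingleton.elim i 0]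
  · simp
  · intro k hk
    rw [Function.update_of_ne (by omega), Pi.zero_apply]
  · simpa using hy
  · simp only [Function.update_apply, Pi.zero_apply]
    grind

end RegProg

theorem impl_zero_test {g : ℕ →. ℕ} (hg : Partrec g) :
    Impl fun c (b : Bool) c' => ∃ n, ∃ y ∈ g n, c = (2 ^ n, 1) ∧
      ((b = true ∧ y ≠ 0 ∧ c' = (3 ^ y - 2, 1)) ∨ (b = false ∧ y = 0 ∧ c' = (0, 1))) := by
  obtain ⟨p, hp⟩ := RegProg.exists_run_of_partrec hg
  obtain ⟨k, hk⟩ := RegProg.exists_usesBelow p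
  have hgodel : ∀ r v, r < 2 → RegProg.godel (k + 2) (Function.update 0 r v) =
      Nat.nth Nat.Prime r ^ v := by
    intro r v hr
    rw [RegProg.godel, Finset.prod_eq_single_of_mem r (Finset.mem_range.2 (by omega))]
    · rw [Function.update_self]
    · intro i _ hi
      rw [Function.update_of_ne hi, Pi.zero_apply, pow_zero]
  refine ((RegProg.impl (hk.mono (Nat.le_add_right k 2))).seq
    (((impl_dec 0 (by norm_num)).map (fun _ => ()) (R' := fun c (_ : Unit) c' =>
      ∃ a, c = (a + 1, 1) ∧ c' = (a, 1)) ?_).seq (impl_dec 0 (by norm_num)))).mono ?_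
  · rintro _ _ _ ⟨a, rfl, rfl⟩
    exact ⟨true, rfl, by simp, Or.inl ⟨rfl, by simp [cmGet], by simp [cmGet, cmSet]⟩⟩
  · rintro _ b c ⟨n, y, hy, rfl, h⟩
    have hpos : 0 < 3 ^ y := by positivity
    refine ⟨_, ⟨_, _, hp n y hy, ?_, rfl⟩, _, ⟨3 ^ y - 1, ?_, rfl⟩, ?_⟩
    · rw [hgodel 0 n (by norm_num), Nat.nth_prime_zero_eq_two]
    · rw [hgodel 1 y (by norm_num), Nat.nth_prime_one_eq_three, Nat.sub_add_cancel hpos]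
    · rcases h with ⟨rfl, h, rfl⟩ | ⟨rfl, rfl, rfl⟩
      · have : 1 < 3 ^ y := Nat.one_lt_pow h (by norm_num)
        refine ⟨by simp, Or.inl ⟨rfl, ?_, ?_⟩⟩
        · simpa [cmGet] using this
        · simp [cmGet, cmSet, Nat.sub_sub]
      · simp [cmGet]

/-- A chain of `K` increments of the first counter, from the state `L + K` to the state `L`. -/
def incChain (L K : ℕ) : List CMTrans := (List.range K).map fun j => (L + j + 1, 0, 0, L + j)

theorem wellFormed_incChain (L K : ℕ) :
    WellFormed (incChain L K) (Set.Ico (L + 1) (L + 1 + K)) {L} := by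
  induction K with
  | zero => refine ⟨?_, ?_, ?_, ?_⟩ <;> simp [incChain]
  | succ K ih =>
    have h := ih.append (wellFormed_inc (L + K + 1) 0 (L + K) (by norm_num)) (X := {L})
      (fun s hs => by simp at hs ⊢; omega) (by simp) (fun s hs => by simp at hs ⊢; omega)
    have hS : Set.Ico (L + 1) (L + 1 + (K + 1)) =
        Set.Ico (L + 1) (L + 1 + K) ∪ {L + K + 1} := by
      ext
      simp
      omega
    rw [hS]
    simpa [incChain, List.range_succ] using h

theorem reach_incChain {M : TwoCM} {L K : ℕ} (hM : incChain L K ⊆ M.1) (a : ℕ) :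
    Reach M (L + K, a, 1) (L, a + K, 1) := by
  induction K generalizing a with
  | zero => exact .refl
  | succ K ih =>
    rw [incChain, List.range_succ, List.map_append, List.append_subset] at hM
    refine .head (b := (L + K, a + 1, 1)) ⟨⟨0, 0, hM.2 ?_, Or.inl ⟨rfl, rfl⟩⟩, by simp⟩ ?_
    · simp [Nat.add_assoc]
    rw [show a + (K + 1) = a + 1 + K by omega]
    exact ih hM.1 (a + 1)

theorem CMDeterministic.step_unique {M : TwoCM} (hM : CMDeterministic M) {c a b : ℕ × ℕ × ℕ}
    (ha : CMStep M c a) (hb : CMStep M c b) : a = b := by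
  obtain ⟨s, c⟩ := c
  obtain ⟨u, a⟩ := a
  obtain ⟨v, b⟩ := b
  obtain ⟨i, op, hi, ha⟩ := ha
  obtain ⟨j, oq, hj, hb⟩ := hb
  have hi' : (s, i, op, u) ∈ cmOutgoing M s := List.mem_filter.2 ⟨hi, by simp⟩
  have hj' : (s, j, oq, v) ∈ cmOutgoing M s := List.mem_filter.2 ⟨hj, by simp⟩
  have hs : s ∈ cmStates M := by
    simp only [cmStates, List.mem_cons, List.mem_append, List.mem_map]
    exact Or.inr (Or.inr (Or.inl ⟨_, hi, rfl⟩))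
  have hsz : s ≠ M.2 := by
    rintro rfl
    rw [hM.2.1] at hi'
    simp at hi'
  simp only [CMCounterSem] at ha hb
  rcases hM.2.2 s hs hsz with ⟨k, w, h⟩ | ⟨k, w, x, h⟩
  · rw [h] at hi' hj'
    simp at hi' hj'
    grind
  · rw [h.mem_iff] at hi' hj'
    simp at hi' hj'
    grind

theorem CMDeterministic.not_step_sink {M : TwoCM} (hM : CMDeterministic M) {c a : ℕ × ℕ × ℕ}
    (hc : c.1 = M.2) : ¬ CMStep M c a := by
  rintro ⟨i, op, hi, -⟩
  have : (c.1, i, op, a.1) ∈ cmOutgoing M M.2 := List.mem_filter.2 ⟨hi, by simp [hc]⟩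
  rw [hM.2.1] at this
  simp at this

/-- If the run reaches the sink without visiting a configuration with both counters zero, then it
visits no such configuration at all. -/
theorem CMDeterministic.ne_zero_of_reach {M : TwoCM} (hM : CMDeterministic M)
    {a e c : ℕ × ℕ × ℕ} (hae : Reach M a e) (he : e.1 = M.2)
    (hac : Relation.ReflTransGen (CMStep M) a c) : c = a ∨ c.2 ≠ (0, 0) := by
  induction hae using Relation.ReflTransGen.head_induction_on with
  | refl =>
    rcases hac.cases_head with rfl | ⟨d, hd, -⟩
    · exact Or.inl rfl
    · exact absurd hd (hM.not_step_sink he)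
  | head hab _ ih =>
    rcases hac.cases_head with rfl | ⟨d, hd, hdc⟩
    · exact Or.inl rfl
    · obtain rfl := hM.step_unique hab.1 hd
      rcases ih hdc with rfl | h
      · exact Or.inr hab.2
      · exact Or.inr h

theorem Reach.toReflTransGen {M : TwoCM} {a b : ℕ × ℕ × ℕ} (h : Reach M a b) :
    Relation.ReflTransGen (CMStep M) a b :=
  h.lift id fun _ _ h => h.1

theorem primrec_two_pow : Primrec fun n : ℕ => 2 ^ n := by
  refine (Primrec.nat_rec₁ 1 (Primrec.nat_add.comp Primrec.snd Primrec.snd).to₂).of_eq fun n => ?_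
  induction n with
  | zero => rfl
  | succ n ih =>
    simp only [pow_succ, mul_two] at ih ⊢
    rw [← ih]

/-- Every partial recursive function is represented by a computable family of machines, whose
runs visit a configuration with both counters zero exactly when the function value is zero. -/
theorem exists_computable_machines {g : ℕ →. ℕ} (hg : Partrec g) :
    ∃ M : ℕ → TwoCM, Computable M ∧ ∀ n, CMDeterministic (M n) ∧ CMFirstIncrements (M n) ∧
      ∀ y ∈ g n, (CMReachesZeroZero (M n) ↔ y = 0) := by
  obtain ⟨l, -, hl⟩ := impl_zero_test hg
  obtain ⟨T, hT, hreach⟩ := hl 2 (fun b => if b then 1 else 2 + l)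
  set z := 2 + l with hz
  set L := 3 + l with hL
  set F : List CMTrans := T ++ [(z, 1, 1, 1), (z, 1, 2, 1)] ++ [(L, 0, 0, 2)] with hF
  set M : ℕ → TwoCM := fun n =>
    (F ++ ((0, 1, 0, L + (2 ^ n - 1)) :: incChain L (2 ^ n - 1)), 1) with hM
  have hFwf := (hT.append (wellFormed_dec z 1 1 1 (by norm_num)) (X := {1})
    (fun s hs => by simp at hs ⊢; omega)
    (by rintro _ ⟨_ | _, rfl⟩ <;> simp) (by simp)).append
    (wellFormed_inc L 0 2 (by norm_num)) (X := {1})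
    (fun s hs => by simp at hs ⊢; omega) (by simp) (fun s hs => by simp at hs ⊢; omega)
  have hdet : ∀ n, CMDeterministic (M n) := by
    intro n
    have hpre := (wellFormed_inc 0 1 (L + (2 ^ n - 1)) (by norm_num)).append
      (wellFormed_incChain L (2 ^ n - 1)) (X := {L})
      (fun s hs => by simp at hs ⊢; omega) (fun s hs => by simp at hs ⊢; omega) (by simp)
    refine (hFwf.append hpre (X := {1}) (fun s hs => ?_) (by simp) (by simp)).deterministic ?_ ?_
    · simp at hs ⊢
      omega
    · simp
    · simp
      omega
  refine ⟨M, ?_, fun n => ⟨hdet n, ⟨(0, 1, 0, L + (2 ^ n - 1)), ?_, rfl, rfl⟩, fun y hy => ?_⟩⟩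
  · have hpow : Primrec fun n : ℕ => 2 ^ n - 1 :=
      Primrec.nat_sub.comp primrec_two_pow (Primrec.const 1)
    have hadd : Primrec fun j : ℕ => L + j := Primrec.nat_add.comp (Primrec.const L) Primrec.id
    have hchain : Primrec fun K => incChain L K :=
      Primrec.list_map Primrec.list_range
        (Primrec.pair (Primrec.succ.comp (hadd.comp Primrec.snd))
          (Primrec.pair (Primrec.const 0) (Primrec.pair (Primrec.const 0)
            (hadd.comp Primrec.snd)))).to₂
    have hhead : Primrec fun n : ℕ => ((0, 1, 0, L + (2 ^ n - 1)) : CMTrans) :=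
      Primrec.pair (Primrec.const 0) (Primrec.pair (Primrec.const 1)
        (Primrec.pair (Primrec.const 0) (hadd.comp hpow)))
    exact (Primrec.pair (Primrec.list_append.comp (Primrec.const F)
      (Primrec.list_cons.comp hhead (hchain.comp hpow))) (Primrec.const 1)).to_comp
  · exact List.mem_append_right _ List.mem_cons_self
  · have hinit : CMStep (M n) cmInit (L + (2 ^ n - 1), 0, 1) :=
      ⟨1, 0, List.mem_append_right _ List.mem_cons_self, Or.inl ⟨rfl, rfl⟩⟩
    have hchain : Reach (M n) (L + (2 ^ n - 1), 0, 1) (L, 0 + (2 ^ n - 1), 1) :=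
      reach_incChain (fun t ht => List.mem_append_right _ (List.mem_cons_of_mem _ ht)) 0
    have hlast : GoodStep (M n) (L, 0 + (2 ^ n - 1), 1) (2, 2 ^ n, 1) := by
      refine ⟨⟨0, 0, List.mem_append_left _ (by simp [hF]), Or.inl ⟨rfl, ?_⟩⟩, by simp⟩
      have : 0 < 2 ^ n := by positivity
      simp [cmSet, cmGet]
      omega
    have hload := hchain.tail hlast
    have hTM : T ⊆ (M n).1 := fun t ht => List.mem_append_left _ (by simp [hF, ht])
    have hrun := fun b c' h => hload.trans (hreach (M n) hTM _ b c' ⟨n, y, hy, rfl, h⟩)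
    constructor
    · rintro ⟨c₁, c, h₁, hc, hc0⟩
      by_contra hy0
      obtain rfl := (hdet n).step_unique hinit h₁
      rcases (hdet n).ne_zero_of_reach (hrun true _ (Or.inl ⟨rfl, hy0, rfl⟩)) rfl hc with rfl | h
      · simp at hc0
      · exact h hc0
    · intro hy0
      refine ⟨_, (1, 0, 0), hinit,
        (Reach.toReflTransGen (hrun false _ (Or.inr ⟨rfl, hy0, rfl⟩))).tail ⟨1, 1, ?_, ?_⟩, rfl⟩
      · exact List.mem_append_left _ (by simp [hF])
      · exact Or.inr (Or.inl ⟨rfl, by simp [cmGet], by simp [cmGet, cmSet]⟩)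

/-- It is undecidable whether the run of a given deterministic
two-counter Minsky machine (whose first transition increments a counter) visits
a configuration in `Q × {(0,0)}` after the initial configuration. -/
theorem undecidable_2CM_reaches_zero_zero :
    ¬ ∃ f : ℕ → Bool, Computable f ∧
      ∀ M : TwoCM, CMDeterministic M → CMFirstIncrements M →
        (f (encodeTwoCM M) = true ↔ CMReachesZeroZero M) := by
  rintro ⟨f, hf, hspec⟩
  have hg : Partrec fun n : ℕ => (Denumerable.ofNat Nat.Partrec.Code n).eval n :=
    Nat.Partrec.Code.eval_part.comp (Computable.ofNat _) Computable.id
  obtain ⟨M, hM, hMspec⟩ := exists_computable_machines hg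
  have hh : Computable fun n => if f (encodeTwoCM (M n)) then 1 else 0 := by
    refine (Computable.cond (hf.comp (Computable.encode.comp hM)) (Computable.const 1)
      (Computable.const 0)).of_eq fun n => ?_
    cases h : f (encodeTwoCM (M n)) <;> simp_all [encodeTwoCM]
  obtain ⟨c, hc⟩ := Nat.Partrec.Code.exists_code.1 (Partrec.nat_iff.1 hh)
  set n := Encodable.encode c
  obtain ⟨hdet, hinc, hval⟩ := hMspec n
  have hy : (if f (encodeTwoCM (M n)) then 1 else 0) ∈
      (Denumerable.ofNat Nat.Partrec.Code n).eval n := by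
    rw [Denumerable.ofNat_encode, hc]
    exact Part.mem_some _
  have h := (hspec (M n) hdet hinc).trans (hval _ hy)
  cases hb : f (encodeTwoCM (M n)) <;> simp [hb] at h
end

section
/- For every deterministic two-counter Minsky machine (Q,T) there exists a deterministic two-counter Minsky machine (Q',T') such that the run of (Q,T) reaches a configuration in {⊥} × ℕ² if and only if the run of (Q',T') reaches a configuration (other than its initial configuration) in which both counters are zero; moreover the construction of (Q',T') from (Q,T) is computable. -/
/-- The code of the `k`-th phase of the simulation of state `s`; the code `0` is left
for the initial state. -/
@[irreducible]
def phaseState (s k : ℕ) : ℕ := 8 * s + k + 1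

/-- The transitions simulating `t` when the first counter is stored increased by one.
A test of the first counter first increments the second counter, so that the two
counters never vanish together while the first one is lowered by one. -/
def simulateTrans (t : CMTrans) : List CMTrans :=
  if t.2.1 ≠ 0 ∨ t.2.2.1 = 0 then
    [(phaseState t.1 0, t.2.1, t.2.2.1, phaseState t.2.2.2 0)]
  else if t.2.2.1 = 1 then
    [(phaseState t.1 0, 1, 0, phaseState t.1 1),
     (phaseState t.1 1, 0, 1, phaseState t.1 2), (phaseState t.1 1, 0, 2, phaseState t.1 2),
     (phaseState t.1 2, 0, 1, phaseState t.1 3),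
     (phaseState t.1 3, 0, 0, phaseState t.1 4),
     (phaseState t.1 4, 1, 1, phaseState t.2.2.2 0),
     (phaseState t.1 4, 1, 2, phaseState t.2.2.2 0)]
  else
    [(phaseState t.1 2, 0, 2, phaseState t.1 5),
     (phaseState t.1 5, 0, 0, phaseState t.1 6),
     (phaseState t.1 6, 1, 1, phaseState t.2.2.2 0),
     (phaseState t.1 6, 1, 2, phaseState t.2.2.2 0)]

/-- The transitions that increment the first counter at the start, and those that empty
both counters once the simulated machine has reached its sink `b`. -/
def startAndDrain (b : ℕ) : List CMTrans :=
  [(0, 0, 0, phaseState 0 0),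
   (phaseState b 0, 0, 1, phaseState b 0), (phaseState b 0, 0, 2, phaseState b 1),
   (phaseState b 1, 1, 1, phaseState b 1), (phaseState b 1, 1, 2, phaseState b 2)]

/-- A machine that simulates `M` without emptying both counters, and empties both of
them once `M` has reached its sink. -/
def haltingToZeroZero (M : TwoCM) : TwoCM :=
  (startAndDrain M.2 ++ M.1.flatMap simulateTrans, phaseState M.2 2)

theorem phaseState_inj {s s' k k' : ℕ} (hk : k < 8) (hk' : k' < 8) :
    phaseState s k = phaseState s' k' ↔ s = s' ∧ k = k' := by
  unfold phaseState; omega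

theorem phaseState_ne_zero (s k : ℕ) : phaseState s k ≠ 0 := by
  unfold phaseState; omega

section Computability

variable {α : Type*} [Primcodable α]

theorem Primrec.phaseState {f : α → ℕ} (hf : Primrec f) (k : ℕ) :
    Primrec fun a => phaseState (f a) k := by
  unfold _root_.phaseState
  exact Primrec.nat_add.comp
    (Primrec.nat_add.comp (Primrec.nat_mul.comp (Primrec.const 8) hf) (Primrec.const k))
    (Primrec.const 1)

theorem Primrec.cmTrans_cons {f g h k : α → ℕ} {l : α → List CMTrans} (hf : Primrec f)
    (hg : Primrec g) (hh : Primrec h) (hk : Primrec k) (hl : Primrec l) :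
    Primrec fun a => ((f a, g a, h a, k a) : CMTrans) :: l a :=
  Primrec.list_cons.comp (hf.pair (hg.pair (hh.pair hk))) hl

theorem primrec_simulateTrans : Primrec simulateTrans := by
  have h1 : Primrec fun t : CMTrans => t.1 := Primrec.fst
  have h2 : Primrec fun t : CMTrans => t.2.1 := Primrec.fst.comp Primrec.snd
  have h3 : Primrec fun t : CMTrans => t.2.2.1 :=
    Primrec.fst.comp (Primrec.snd.comp Primrec.snd)
  have h4 : Primrec fun t : CMTrans => t.2.2.2 :=
    Primrec.snd.comp (Primrec.snd.comp Primrec.snd)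
  have c (n : ℕ) : Primrec fun _ : CMTrans => n := Primrec.const n
  have p (k : ℕ) := h1.phaseState k
  have q := h4.phaseState 0
  have nil : Primrec fun _ : CMTrans => ([] : List CMTrans) := Primrec.const []
  refine Primrec.ite (((Primrec.eq.comp h2 (c 0)).not).or (Primrec.eq.comp h3 (c 0))) ?_
    (Primrec.ite (Primrec.eq.comp h3 (c 1)) ?_ ?_)
  · exact (p 0).cmTrans_cons h2 h3 q nil
  · exact (p 0).cmTrans_cons (c 1) (c 0) (p 1) <| (p 1).cmTrans_cons (c 0) (c 1) (p 2) <|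
      (p 1).cmTrans_cons (c 0) (c 2) (p 2) <| (p 2).cmTrans_cons (c 0) (c 1) (p 3) <|
      (p 3).cmTrans_cons (c 0) (c 0) (p 4) <| (p 4).cmTrans_cons (c 1) (c 1) q <|
      (p 4).cmTrans_cons (c 1) (c 2) q nil
  · exact (p 2).cmTrans_cons (c 0) (c 2) (p 5) <| (p 5).cmTrans_cons (c 0) (c 0) (p 6) <|
      (p 6).cmTrans_cons (c 1) (c 1) q <| (p 6).cmTrans_cons (c 1) (c 2) q nil

theorem primrec_startAndDrain : Primrec startAndDrain := by
  have c (n : ℕ) : Primrec fun _ : ℕ => n := Primrec.const n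
  have p (k : ℕ) : Primrec fun b : ℕ => phaseState b k := Primrec.id.phaseState k
  exact (c 0).cmTrans_cons (c 0) (c 0) (c _) <| (p 0).cmTrans_cons (c 0) (c 1) (p 0) <|
    (p 0).cmTrans_cons (c 0) (c 2) (p 1) <| (p 1).cmTrans_cons (c 1) (c 1) (p 1) <|
    (p 1).cmTrans_cons (c 1) (c 2) (p 2) (Primrec.const [])

theorem primrec_haltingToZeroZero : Primrec haltingToZeroZero :=
  (Primrec.list_append.comp (primrec_startAndDrain.comp Primrec.snd)
    (Primrec.list_flatMap Primrec.fst (primrec_simulateTrans.comp Primrec.snd).to₂)).pair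
    (Primrec.snd.phaseState 2)

end Computability

section Determinism

theorem exists_phaseState_of_mem_simulateTrans {t t' : CMTrans} (h : t' ∈ simulateTrans t) :
    ∃ k < 7, t'.1 = phaseState t.1 k := by
  unfold simulateTrans at h
  split_ifs at h <;> simp only [List.mem_cons, List.not_mem_nil, or_false] at h
  · exact ⟨0, by norm_num, by rw [h]⟩
  · rcases h with h | h | h | h | h | h | h <;> rw [h] <;> exact ⟨_, by norm_num, rfl⟩
  · rcases h with h | h | h | h <;> rw [h] <;> exact ⟨_, by norm_num, rfl⟩

theorem fst_eq_of_mem_simulateTrans {t t' : CMTrans} {s k : ℕ} (h : t' ∈ simulateTrans t)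
    (hk : k < 8) (hs : t'.1 = phaseState s k) : t.1 = s := by
  obtain ⟨k', hk', h'⟩ := exists_phaseState_of_mem_simulateTrans h
  exact ((phaseState_inj (by omega) hk).1 (h'.symm.trans hs)).1

theorem filter_flatMap_simulateTrans (l : List CMTrans) {s k : ℕ} (hk : k < 8) :
    (l.flatMap simulateTrans).filter (fun t => t.1 = phaseState s k) =
      ((l.filter (fun t => t.1 = s)).flatMap simulateTrans).filter
        (fun t => t.1 = phaseState s k) := by
  induction l with
  | nil => rfl
  | cons t l ih =>
    by_cases h : t.1 = s
    · simp [h, ih]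
    · have : (simulateTrans t).filter (fun t' => t'.1 = phaseState s k) = [] := by
        simp only [List.filter_eq_nil_iff, decide_eq_true_eq]
        exact fun t' ht' hs => h (fst_eq_of_mem_simulateTrans ht' hk hs)
      simp [h, ih, this]

theorem cmOutgoing_haltingToZeroZero (M : TwoCM) {s k : ℕ} (hk : k < 8) :
    cmOutgoing (haltingToZeroZero M) (phaseState s k) =
      cmOutgoing (startAndDrain M.2, 0) (phaseState s k) ++
        ((cmOutgoing M s).flatMap simulateTrans).filter (fun t => t.1 = phaseState s k) := by
  simp only [cmOutgoing, haltingToZeroZero, List.filter_append]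
  rw [filter_flatMap_simulateTrans _ hk]

theorem cmOutgoing_haltingToZeroZero_of_ne (M : TwoCM) {s k : ℕ} (hk : k < 8) (hs : s ≠ M.2) :
    cmOutgoing (haltingToZeroZero M) (phaseState s k) =
      ((cmOutgoing M s).flatMap simulateTrans).filter (fun t => t.1 = phaseState s k) := by
  rw [cmOutgoing_haltingToZeroZero M hk]
  simp [cmOutgoing, startAndDrain, phaseState_inj, hk, (phaseState_ne_zero s k).symm, hs.symm]

theorem mem_cmOutgoing {M : TwoCM} {t : CMTrans} (h : t ∈ M.1) : t ∈ cmOutgoing M t.1 := by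
  simp [cmOutgoing, h]

theorem fst_mem_cmStates {M : TwoCM} {t : CMTrans} (h : t ∈ M.1) : t.1 ∈ cmStates M := by
  simp only [cmStates, List.mem_cons, List.mem_append, List.mem_map]
  exact Or.inr (Or.inr (Or.inl ⟨t, h, rfl⟩))

theorem target_mem_cmStates {M : TwoCM} {t : CMTrans} (h : t ∈ M.1) :
    t.2.2.2 ∈ cmStates M := by
  simp only [cmStates, List.mem_cons, List.mem_append, List.mem_map]
  exact Or.inr (Or.inr (Or.inr ⟨t, h, rfl⟩))

theorem CMDeterministic.ne_sink {M : TwoCM} (hM : CMDeterministic M) {t : CMTrans} (ht : t ∈ M.1) :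
    t.1 ≠ M.2 := fun h => by
  have := mem_cmOutgoing ht
  rw [h, hM.2.1] at this
  exact List.not_mem_nil this

/-- The states of `haltingToZeroZero M`. -/
inductive PhaseStateOf (M : TwoCM) : ℕ → Prop
  | start : PhaseStateOf M 0
  | main {s : ℕ} : s ∈ cmStates M → PhaseStateOf M (phaseState s 0)
  | drain : PhaseStateOf M (phaseState M.2 1)
  | sink : PhaseStateOf M (phaseState M.2 2)
  | test {t : CMTrans} {k : ℕ} : t ∈ M.1 → t.2.1 = 0 → t.2.2.1 ≠ 0 → k < 7 →
      PhaseStateOf M (phaseState t.1 k)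

theorem phaseStateOf_of_mem_simulateTrans {M : TwoCM} {t t' : CMTrans} (ht : t ∈ M.1)
    (h : t' ∈ simulateTrans t) : PhaseStateOf M t'.1 ∧ PhaseStateOf M t'.2.2.2 := by
  have hu : PhaseStateOf M (phaseState t.2.2.2 0) := .main (target_mem_cmStates ht)
  unfold simulateTrans at h
  split_ifs at h with h1 h2 <;> simp only [List.mem_cons, List.not_mem_nil, or_false] at h
  · subst h
    exact ⟨.main (fst_mem_cmStates ht), hu⟩
  all_goals
    rw [not_or, not_not] at h1
    have hk {k : ℕ} (hk : k < 7) : PhaseStateOf M (phaseState t.1 k) := .test ht h1.1 h1.2 hk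
  · rcases h with h | h | h | h | h | h | h <;> subst h <;>
      exact ⟨hk (by norm_num), by first | exact hu | exact hk (by norm_num)⟩
  · rcases h with h | h | h | h <;> subst h <;>
      exact ⟨hk (by norm_num), by first | exact hu | exact hk (by norm_num)⟩

theorem phaseStateOf_of_mem {M : TwoCM} {t : CMTrans} (h : t ∈ (haltingToZeroZero M).1) :
    PhaseStateOf M t.1 ∧ PhaseStateOf M t.2.2.2 := by
  have hb : PhaseStateOf M (phaseState M.2 0) := .main (by simp [cmStates])
  rcases List.mem_append.1 h with h | h
  · simp only [startAndDrain, List.mem_cons, List.not_mem_nil, or_false] at h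
    rcases h with h | h | h | h | h <;> subst h
    · exact ⟨.start, .main (by simp [cmStates])⟩
    · exact ⟨hb, hb⟩
    · exact ⟨hb, .drain⟩
    · exact ⟨.drain, .drain⟩
    · exact ⟨.drain, .sink⟩
  · obtain ⟨t₀, h₀, h⟩ := List.mem_flatMap.1 h
    exact phaseStateOf_of_mem_simulateTrans h₀ h

theorem phaseStateOf_of_mem_cmStates {M : TwoCM} {x : ℕ}
    (h : x ∈ cmStates (haltingToZeroZero M)) : PhaseStateOf M x := by
  simp only [cmStates, List.mem_cons, List.mem_append, List.mem_map] at h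
  rcases h with h | h | ⟨t, ht, h⟩ | ⟨t, ht, h⟩
  · exact h ▸ .start
  · exact h ▸ .sink
  · exact h ▸ (phaseStateOf_of_mem ht).1
  · exact h ▸ (phaseStateOf_of_mem ht).2

theorem inRange_of_mem_simulateTrans {t t' : CMTrans} (ht : t.2.1 < 2 ∧ t.2.2.1 < 3)
    (h : t' ∈ simulateTrans t) : t'.2.1 < 2 ∧ t'.2.2.1 < 3 := by
  unfold simulateTrans at h
  split_ifs at h <;> simp only [List.mem_cons, List.not_mem_nil, or_false] at h
  · exact h ▸ ht
  · rcases h with h | h | h | h | h | h | h <;> simp [h]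
  · rcases h with h | h | h | h <;> simp [h]

/-- The outgoing transitions of a state form an increment, or a decrement together with a
zero-test of the same counter. -/
def CMBranches (M : TwoCM) (s : ℕ) : Prop :=
  (∃ i u, cmOutgoing M s = [(s, i, 0, u)]) ∨
    (∃ i u v, (cmOutgoing M s).Perm [(s, i, 1, u), (s, i, 2, v)])

theorem cmBranches_main {M : TwoCM} {s : ℕ} (hs : s ≠ M.2) (h : CMBranches M s) :
    CMBranches (haltingToZeroZero M) (phaseState s 0) := by
  unfold CMBranches
  rw [cmOutgoing_haltingToZeroZero_of_ne M (by norm_num) hs]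
  rcases h with ⟨i, u, h⟩ | ⟨i, u, v, h⟩
  · rw [h]
    exact Or.inl ⟨i, phaseState u 0, by simp [simulateTrans]⟩
  · have h' := (h.flatMap_right simulateTrans).filter (fun t => t.1 = phaseState s 0)
    by_cases hi : i = 0
    · subst hi
      refine Or.inl ⟨1, phaseState s 1, List.perm_singleton.1 (h'.trans (.of_eq ?_))⟩
      simp [simulateTrans, phaseState_inj]
    · refine Or.inr ⟨i, phaseState u 0, phaseState v 0, h'.trans (.of_eq ?_)⟩
      simp [simulateTrans, hi]

theorem cmBranches_test {M : TwoCM} {t : CMTrans} (ht : t ∈ M.1) (h0 : t.2.1 = 0)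
    (h1 : t.2.2.1 ≠ 0) (hs : t.1 ≠ M.2) (h : CMBranches M t.1) {k : ℕ} (hk : k < 7) :
    CMBranches (haltingToZeroZero M) (phaseState t.1 k) := by
  by_cases hk0 : k = 0
  · exact hk0 ▸ cmBranches_main hs h
  have hmem := mem_cmOutgoing ht
  unfold CMBranches
  rw [cmOutgoing_haltingToZeroZero_of_ne M (by omega) hs]
  rcases h with ⟨i, u, h⟩ | ⟨i, u, v, h⟩
  · rw [h, List.mem_singleton] at hmem
    rw [hmem] at h1
    exact absurd rfl h1
  · have hi : i = 0 := by
      rw [h.mem_iff] at hmem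
      simp only [List.mem_cons, List.not_mem_nil, or_false] at hmem
      rcases hmem with hmem | hmem <;> rw [hmem] at h0 <;> exact h0
    subst hi
    have h' := (h.flatMap_right simulateTrans).filter (fun t' => t'.1 = phaseState t.1 k)
    interval_cases k
    · exact absurd rfl hk0
    · exact Or.inr ⟨0, phaseState t.1 2, phaseState t.1 2,
        h'.trans (.of_eq (by simp [simulateTrans, phaseState_inj]))⟩
    · exact Or.inr ⟨0, phaseState t.1 3, phaseState t.1 5,
        h'.trans (.of_eq (by simp [simulateTrans, phaseState_inj]))⟩
    · exact Or.inl ⟨0, phaseState t.1 4, List.perm_singleton.1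
        (h'.trans (.of_eq (by simp [simulateTrans, phaseState_inj])))⟩
    · exact Or.inr ⟨1, phaseState u 0, phaseState u 0,
        h'.trans (.of_eq (by simp [simulateTrans, phaseState_inj]))⟩
    · exact Or.inl ⟨0, phaseState t.1 6, List.perm_singleton.1
        (h'.trans (.of_eq (by simp [simulateTrans, phaseState_inj])))⟩
    · exact Or.inr ⟨1, phaseState v 0, phaseState v 0,
        h'.trans (.of_eq (by simp [simulateTrans, phaseState_inj]))⟩

theorem cmOutgoing_haltingToZeroZero_zero (M : TwoCM) :
    cmOutgoing (haltingToZeroZero M) 0 = [(0, 0, 0, phaseState 0 0)] := by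
  have : (M.1.flatMap simulateTrans).filter (fun t => t.1 = 0) = [] := by
    simp only [List.filter_eq_nil_iff, decide_eq_true_eq, List.mem_flatMap]
    rintro t ⟨t₀, -, ht⟩ h
    obtain ⟨k, -, hk⟩ := exists_phaseState_of_mem_simulateTrans ht
    exact phaseState_ne_zero _ _ (hk.symm.trans h)
  simp only [cmOutgoing, haltingToZeroZero, List.filter_append, this]
  simp [startAndDrain, phaseState_ne_zero]

theorem CMDeterministic.haltingToZeroZero {M : TwoCM} (hM : CMDeterministic M) :
    CMDeterministic (haltingToZeroZero M) := by
  obtain ⟨hrange, hsink, hout⟩ := hM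
  refine ⟨fun t ht => ?_, ?_, fun x hx hne => ?_⟩
  · rcases List.mem_append.1 ht with h | h
    · simp only [startAndDrain, List.mem_cons, List.not_mem_nil, or_false] at h
      rcases h with h | h | h | h | h <;> simp [h]
    · obtain ⟨t₀, h₀, h⟩ := List.mem_flatMap.1 h
      exact inRange_of_mem_simulateTrans (hrange _ h₀) h
  · change cmOutgoing _ (phaseState M.2 2) = []
    rw [cmOutgoing_haltingToZeroZero M (by norm_num), hsink]
    simp [cmOutgoing, startAndDrain, phaseState_inj, (phaseState_ne_zero _ _).symm]
  · change CMBranches _ x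
    cases phaseStateOf_of_mem_cmStates hx with
    | start => exact Or.inl ⟨0, phaseState 0 0, cmOutgoing_haltingToZeroZero_zero M⟩
    | @main s hs =>
      by_cases h : s = M.2
      · subst h
        refine Or.inr ⟨0, phaseState M.2 0, phaseState M.2 1, .of_eq ?_⟩
        rw [cmOutgoing_haltingToZeroZero M (by norm_num), hsink]
        simp [cmOutgoing, startAndDrain, phaseState_inj, (phaseState_ne_zero _ _).symm]
      · exact cmBranches_main h (hout s hs h)
    | drain =>
      refine Or.inr ⟨1, phaseState M.2 1, phaseState M.2 2, .of_eq ?_⟩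
      rw [cmOutgoing_haltingToZeroZero M (by norm_num), hsink]
      simp [cmOutgoing, startAndDrain, phaseState_inj, (phaseState_ne_zero _ _).symm]
    | sink => exact absurd rfl hne
    | @test t k ht h0 h1 hk =>
      have hs := CMDeterministic.ne_sink ⟨hrange, hsink, hout⟩ ht
      exact cmBranches_test ht h0 h1 hs (hout _ (fst_mem_cmStates ht) hs) hk

end Determinism

section Simulation

open Relation

variable {M : TwoCM}

theorem CMStep.inc_fst {s s' y z : ℕ} (h : (s, 0, 0, s') ∈ M.1) :
    CMStep M (s, y, z) (s', y + 1, z) :=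
  ⟨0, 0, h, by simp [CMCounterSem, cmSet, cmGet]⟩

theorem CMStep.inc_snd {s s' y z : ℕ} (h : (s, 1, 0, s') ∈ M.1) :
    CMStep M (s, y, z) (s', y, z + 1) :=
  ⟨1, 0, h, by simp [CMCounterSem, cmSet, cmGet]⟩

theorem CMStep.dec_fst {s s' y z : ℕ} (h : (s, 0, 1, s') ∈ M.1) :
    CMStep M (s, y + 1, z) (s', y, z) :=
  ⟨0, 1, h, by simp [CMCounterSem, cmSet, cmGet]⟩

theorem CMStep.dec_snd {s s' y z : ℕ} (h : (s, 1, 1, s') ∈ M.1) :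
    CMStep M (s, y, z + 1) (s', y, z) :=
  ⟨1, 1, h, by simp [CMCounterSem, cmSet, cmGet]⟩

theorem CMStep.zero_fst {s s' z : ℕ} (h : (s, 0, 2, s') ∈ M.1) :
    CMStep M (s, 0, z) (s', 0, z) :=
  ⟨0, 2, h, by simp [CMCounterSem, cmGet]⟩

theorem CMStep.zero_snd {s s' y : ℕ} (h : (s, 1, 2, s') ∈ M.1) :
    CMStep M (s, y, 0) (s', y, 0) :=
  ⟨1, 2, h, by simp [CMCounterSem, cmGet]⟩

theorem mem_haltingToZeroZero_of_startAndDrain {t : CMTrans} (h : t ∈ startAndDrain M.2) :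
    t ∈ (haltingToZeroZero M).1 :=
  List.mem_append_left _ h

theorem mem_haltingToZeroZero_of_simulateTrans {t t' : CMTrans} (ht : t ∈ M.1)
    (h : t' ∈ simulateTrans t) : t' ∈ (haltingToZeroZero M).1 :=
  List.mem_append_right _ (List.mem_flatMap.2 ⟨t, ht, h⟩)

theorem reflTransGen_drain (y z : ℕ) :
    ReflTransGen (CMStep (haltingToZeroZero M)) (phaseState M.2 0, y, z)
      (phaseState M.2 2, 0, 0) := by
  have mem {t : CMTrans} (h : t ∈ startAndDrain M.2) :=
    mem_haltingToZeroZero_of_startAndDrain h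
  induction y with
  | succ y ih => exact .head (.dec_fst (mem (by simp [startAndDrain]))) ih
  | zero =>
    refine .head (.zero_fst (s' := phaseState M.2 1) (mem (by simp [startAndDrain]))) ?_
    induction z with
    | succ z ih => exact .head (.dec_snd (mem (by simp [startAndDrain]))) ih
    | zero => exact .single (.zero_snd (mem (by simp [startAndDrain])))

theorem CMDeterministic.exists_dec_of_zeroTest (hM : CMDeterministic M) {s i v : ℕ}
    (ht : (s, i, 2, v) ∈ M.1) : ∃ u, (s, i, 1, u) ∈ M.1 := by
  have hmem := mem_cmOutgoing ht
  rcases hM.2.2 s (fst_mem_cmStates ht) (hM.ne_sink ht) with ⟨j, u, h⟩ | ⟨j, u, v', h⟩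
  · simp [h] at hmem
  · have hu : (s, j, 1, u) ∈ cmOutgoing M s := h.mem_iff.2 (by simp)
    have hj : i = j ∧ v = v' := by simpa using h.mem_iff.1 hmem
    exact ⟨u, hj.1 ▸ (List.mem_filter.1 hu).1⟩

theorem CMStep.simulate (hM : CMDeterministic M) {s s' y z y' z' : ℕ}
    (h : CMStep M (s, y, z) (s', y', z')) :
    ReflTransGen (CMStep (haltingToZeroZero M)) (phaseState s 0, y + 1, z)
      (phaseState s' 0, y' + 1, z') := by
  obtain ⟨i, op, ht, h⟩ := h
  have hi : i < 2 := (hM.1 _ ht).1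
  dsimp only at ht h
  have mem {t : CMTrans} (h : t ∈ simulateTrans (s, i, op, s')) :=
    mem_haltingToZeroZero_of_simulateTrans ht h
  rcases h with ⟨rfl, h⟩ | ⟨rfl, hpos, h⟩ | ⟨rfl, hzero, h⟩ <;> interval_cases i <;>
    simp only [cmSet, cmGet, Prod.mk.injEq, if_true, one_ne_zero, if_false] at * <;>
    obtain ⟨rfl, rfl⟩ := h
  · exact .single (.inc_fst (mem (by simp [simulateTrans])))
  · exact .single (.inc_snd (mem (by simp [simulateTrans])))
  · obtain ⟨y, rfl⟩ := Nat.exists_eq_succ_of_ne_zero hpos.ne'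
    exact .head (.inc_snd (s' := phaseState s 1) (mem (by simp [simulateTrans]))) <|
      .head (.dec_fst (s' := phaseState s 2) (mem (by simp [simulateTrans]))) <|
      .head (.dec_fst (s' := phaseState s 3) (mem (by simp [simulateTrans]))) <|
      .head (.inc_fst (s' := phaseState s 4) (mem (by simp [simulateTrans]))) <|
      .single (.dec_snd (mem (by simp [simulateTrans])))
  · obtain ⟨z, rfl⟩ := Nat.exists_eq_succ_of_ne_zero hpos.ne'
    exact .single (.dec_snd (mem (by simp [simulateTrans])))
  · subst hzero
    obtain ⟨u, hu⟩ := hM.exists_dec_of_zeroTest ht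
    have mem' {t : CMTrans} (h : t ∈ simulateTrans (s, 0, 1, u)) :=
      mem_haltingToZeroZero_of_simulateTrans hu h
    exact .head (.inc_snd (s' := phaseState s 1) (mem' (by simp [simulateTrans]))) <|
      .head (.dec_fst (s' := phaseState s 2) (mem' (by simp [simulateTrans]))) <|
      .head (.zero_fst (s' := phaseState s 5) (mem (by simp [simulateTrans]))) <|
      .head (.inc_fst (s' := phaseState s 6) (mem (by simp [simulateTrans]))) <|
      .single (.dec_snd (mem (by simp [simulateTrans])))
  · subst hzero
    exact .single (.zero_snd (mem (by simp [simulateTrans])))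

/-- `Encodes c d`: the simulating machine may be in configuration `d` while it simulates
configuration `c`. -/
inductive Encodes : ℕ × ℕ × ℕ → ℕ × ℕ × ℕ → Prop
  | main (s y z : ℕ) : Encodes (s, y, z) (phaseState s 0, y + 1, z)
  | lift (s y z : ℕ) : Encodes (s, y, z) (phaseState s 1, y + 1, z + 1)
  | test (s y z : ℕ) : Encodes (s, y, z) (phaseState s 2, y, z + 1)
  | pos (s y z : ℕ) : Encodes (s, y + 1, z) (phaseState s 3, y, z + 1)
  | posRestored (s y z : ℕ) : Encodes (s, y + 1, z) (phaseState s 4, y + 1, z + 1)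
  | zero (s z : ℕ) : Encodes (s, 0, z) (phaseState s 5, 0, z + 1)
  | zeroRestored (s z : ℕ) : Encodes (s, 0, z) (phaseState s 6, 1, z + 1)

theorem Encodes.counters_ne_zero {c d : ℕ × ℕ × ℕ} (h : Encodes c d) : d.2 ≠ (0, 0) := by
  cases h <;> simp

theorem cmStep_haltingToZeroZero {s k : ℕ} (hk : k < 8) {c : ℕ × ℕ} {d : ℕ × ℕ × ℕ}
    (h : CMStep (haltingToZeroZero M) (phaseState s k, c) d) :
    s = M.2 ∨ ∃ i op u j op', (s, i, op, u) ∈ M.1 ∧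
      (phaseState s k, j, op', d.1) ∈ simulateTrans (s, i, op, u) ∧
      CMCounterSem j op' c d.2 := by
  obtain ⟨j, op', hmem, hsem⟩ := h
  rcases List.mem_append.1 hmem with h | h
  · left
    simp only [startAndDrain, List.mem_cons, List.not_mem_nil, or_false, Prod.mk.injEq,
      phaseState_ne_zero, false_and, false_or] at h
    rcases h with h | h | h | h <;> exact ((phaseState_inj hk (by norm_num)).1 h.1).1
  · obtain ⟨⟨s', i, op, u⟩, ht, h⟩ := List.mem_flatMap.1 h
    obtain rfl : s' = s := fst_eq_of_mem_simulateTrans h hk rfl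
    exact Or.inr ⟨i, op, u, j, op', ht, h, hsem⟩

theorem Encodes.step (hM : CMDeterministic M) {c d d' : ℕ × ℕ × ℕ} (h : Encodes c d)
    (hd : CMStep (haltingToZeroZero M) d d') :
    c.1 = M.2 ∨ Encodes c d' ∨ ∃ c', CMStep M c c' ∧ Encodes c' d' := by
  obtain ⟨x, y', z'⟩ := d'
  cases h <;> (
    rcases cmStep_haltingToZeroZero (by norm_num) hd with h | ⟨i, op, u, j, op', ht, h, hsem⟩
    · exact Or.inl h
    right
    have hrange := hM.1 _ ht
    dsimp only at hrange h hsem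
    obtain ⟨hi, hop⟩ := hrange
    interval_cases i <;> interval_cases op <;>
      simp [simulateTrans, phaseState_inj] at h
    all_goals
      first
        | obtain ⟨rfl, rfl, rfl⟩ : _ ∧ _ ∧ _ := h
        | obtain ⟨rfl, rfl, rfl⟩ | ⟨rfl, rfl, rfl⟩ := h
      all_goals simp [CMCounterSem, cmGet, cmSet] at hsem)
  · obtain ⟨rfl, rfl⟩ := hsem
    exact Or.inr ⟨_, .inc_fst ht, .main ..⟩
  · obtain ⟨rfl, rfl⟩ := hsem
    exact Or.inl (.lift ..)
  · obtain ⟨rfl, rfl⟩ := hsem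
    exact Or.inr ⟨_, .inc_snd ht, .main ..⟩
  · obtain ⟨hz, rfl, rfl⟩ := hsem
    obtain ⟨z, rfl⟩ := Nat.exists_eq_succ_of_ne_zero hz.ne'
    exact Or.inr ⟨_, .dec_snd ht, .main ..⟩
  · obtain ⟨rfl, rfl, rfl⟩ := hsem
    exact Or.inr ⟨_, .zero_snd ht, .main ..⟩
  · obtain ⟨rfl, rfl⟩ := hsem
    exact Or.inl (.test ..)
  · obtain ⟨hy, rfl, rfl⟩ := hsem
    obtain ⟨y, rfl⟩ := Nat.exists_eq_succ_of_ne_zero hy.ne'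
    exact Or.inl (.pos ..)
  · obtain ⟨rfl, rfl, rfl⟩ := hsem
    exact Or.inl (.zero ..)
  · obtain ⟨rfl, rfl⟩ := hsem
    exact Or.inl (.posRestored ..)
  · obtain ⟨rfl, rfl⟩ := hsem
    exact Or.inr ⟨_, .dec_fst ht, .main ..⟩
  · obtain ⟨rfl, rfl⟩ := hsem
    exact Or.inl (.zeroRestored ..)
  · obtain ⟨rfl, rfl⟩ := hsem
    exact Or.inr ⟨_, .zero_fst ht, .main ..⟩

theorem Encodes.reachesSink_or_of_reflTransGen (hM : CMDeterministic M) {d d' : ℕ × ℕ × ℕ}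
    (hd : ReflTransGen (CMStep (haltingToZeroZero M)) d d')
    (h : ∃ c, ReflTransGen (CMStep M) cmInit c ∧ Encodes c d) :
    CMReachesSink M ∨ ∃ c, ReflTransGen (CMStep M) cmInit c ∧ Encodes c d' := by
  induction hd with
  | refl => exact Or.inr h
  | tail _ hstep ih =>
    rcases ih with ih | ⟨c, hc, ih⟩
    · exact Or.inl ih
    · rcases ih.step hM hstep with h | h | ⟨c', hc', h⟩
      · exact Or.inl ⟨c, hc, h⟩
      · exact Or.inr ⟨c, hc, h⟩
      · exact Or.inr ⟨c', hc.tail hc', h⟩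

theorem CMStep.eq_of_haltingToZeroZero_init {d : ℕ × ℕ × ℕ}
    (h : CMStep (haltingToZeroZero M) cmInit d) : d = (phaseState 0 0, 1, 0) := by
  obtain ⟨i, op, hmem, hsem⟩ := h
  have hout := mem_cmOutgoing hmem
  simp only [cmInit, cmOutgoing_haltingToZeroZero_zero, List.mem_singleton,
    Prod.mk.injEq, true_and] at hout
  obtain ⟨rfl, rfl, hd⟩ := hout
  have hc : d.2 = (1, 0) := by simpa [CMCounterSem, cmInit, cmGet, cmSet] using hsem
  exact Prod.ext hd hc

theorem reflTransGen_simulate (hM : CMDeterministic M) {c : ℕ × ℕ × ℕ}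
    (h : ReflTransGen (CMStep M) cmInit c) :
    ReflTransGen (CMStep (haltingToZeroZero M)) (phaseState 0 0, 1, 0)
      (phaseState c.1 0, c.2.1 + 1, c.2.2) := by
  induction h with
  | refl => exact .refl
  | tail _ hstep ih => exact ih.trans (hstep.simulate hM)

theorem CMDeterministic.reachesSink_iff_reachesZeroZero (hM : CMDeterministic M) :
    CMReachesSink M ↔ CMReachesZeroZero (_root_.haltingToZeroZero M) := by
  constructor
  · rintro ⟨⟨s, y, z⟩, hc, rfl⟩
    exact ⟨(phaseState 0 0, 1, 0), (phaseState M.2 2, 0, 0),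
      .inc_fst (mem_haltingToZeroZero_of_startAndDrain (by simp [startAndDrain])),
      (reflTransGen_simulate hM hc).trans (reflTransGen_drain _ _), rfl⟩
  · rintro ⟨d₁, d, hfirst, hd, hzero⟩
    obtain rfl := hfirst.eq_of_haltingToZeroZero_init
    rcases Encodes.reachesSink_or_of_reflTransGen hM hd ⟨cmInit, .refl, .main 0 0 0⟩ with
      h | ⟨c, -, h⟩
    · exact h
    · exact absurd hzero h.counters_ne_zero

end Simulation

/-- For every deterministic two-counter Minsky machine there is
a deterministic two-counter Minsky machine whose run visits a configuration with
both counters zero (after its initial configuration) if and only if the run of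
the original machine reaches the sink; moreover the construction is computable. -/
theorem exists_computable_reduction_halting_to_zero_zero :
    ∃ F : TwoCM → TwoCM, Computable F ∧
      ∀ M : TwoCM, CMDeterministic M →
        CMDeterministic (F M) ∧ (CMReachesSink M ↔ CMReachesZeroZero (F M)) :=
  ⟨haltingToZeroZero, primrec_haltingToZeroZero.to_comp, fun _ hM =>
    ⟨hM.haltingToZeroZero, hM.reachesSink_iff_reachesZeroZero⟩⟩
end

section
/- Let (Q,T) be a deterministic two-counter Minsky machine and (Q',T') its flag machine. Then the run of (Q,T) visits a configuration (s,(y,z)) if and only if the unique run of (Q',T') in which every chosen transition leads to a state whose flags match the resulting counter values visits the configuration (s_{ab},(y,z)) with a = + iff y > 0 and b = + iff z > 0. In particular, the run of (Q,T) reaches a configuration in Q × {(0,0)} if and only if this run of (Q',T') reaches a configuration in Q' × {(0,0)}. -/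
/-- A state of the flag machine `(Q',T')`: a state of the original machine
together with two positivity flags (`true` = `+`, `false` = `0`). -/
abbrev FState : Type := ℕ × Bool × Bool

/-- The transitions of the flag machine `(Q',T')` constructed from `M`. -/
def FlagTrans (M : TwoCM) (p : FState) (i op : ℕ) (q : FState) : Prop :=
  (p.1, i, op, q.1) ∈ M.1 ∧
  ((op = 0 ∧ i = 0 ∧ q.2.1 = true ∧ q.2.2 = p.2.2) ∨
   (op = 0 ∧ i = 1 ∧ q.2.1 = p.2.1 ∧ q.2.2 = true) ∨
   (op = 1 ∧ i = 0 ∧ p.2.1 = true ∧ q.2.2 = p.2.2) ∨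
   (op = 1 ∧ i = 1 ∧ p.2.2 = true ∧ q.2.1 = p.2.1) ∨
   (op = 2 ∧ i = 0 ∧ p.2.1 = false ∧ q.2.1 = false ∧ q.2.2 = p.2.2) ∨
   (op = 2 ∧ i = 1 ∧ p.2.2 = false ∧ q.2.2 = false ∧ q.2.1 = p.2.1))

/-- The flags match the counter values: a flag is `+` iff the counter is positive. -/
def FlagsMatch (ab : Bool × Bool) (c : ℕ × ℕ) : Prop :=
  ab.1 = decide (0 < c.1) ∧ ab.2 = decide (0 < c.2)

/-- One step of the flag machine `(Q',T')` in the run in which every chosen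
transition leads to a state whose flags match the resulting counter values. -/
def FlagStep (M : TwoCM) (c c' : FState × ℕ × ℕ) : Prop :=
  ∃ i op, FlagTrans M c.1 i op c'.1 ∧ CMCounterSem i op c.2 c'.2 ∧
    FlagsMatch c'.1.2 c'.2

/-- The initial configuration `(s0_{00}, (0, 0))` of the flag machine. -/
def flagInit : FState × ℕ × ℕ := ((0, false, false), 0, 0)

/-- The configuration of the flag machine whose flags record positivity of the counters. -/
def withFlags (c : ℕ × ℕ × ℕ) : FState × ℕ × ℕ :=
  ((c.1, decide (0 < c.2.1), decide (0 < c.2.2)), c.2)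

/-- Forgetting the flags of a configuration of the flag machine. -/
def forgetFlags (c : FState × ℕ × ℕ) : ℕ × ℕ × ℕ := (c.1.1, c.2)

theorem FlagStep.forgetFlags {M : TwoCM} {c c' : FState × ℕ × ℕ} (h : FlagStep M c c') :
    CMStep M (forgetFlags c) (forgetFlags c') := by
  obtain ⟨i, op, ht, hs, -⟩ := h
  exact ⟨i, op, ht.1, hs⟩

theorem CMStep.withFlags {M : TwoCM} (hM : ∀ t ∈ M.1, t.2.1 < 2) {c c' : ℕ × ℕ × ℕ}
    (h : CMStep M c c') : FlagStep M (withFlags c) (withFlags c') := by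
  obtain ⟨i, op, ht, hs⟩ := h
  refine ⟨i, op, ⟨ht, ?_⟩, hs, rfl, rfl⟩
  obtain ⟨s, y, z⟩ := c
  obtain ⟨s', y', z'⟩ := c'
  have hi : i < 2 := hM _ ht
  interval_cases i <;>
    rcases hs with ⟨rfl, h⟩ | ⟨rfl, hp, h⟩ | ⟨rfl, hz, h⟩ <;>
    simp_all [_root_.withFlags, cmGet, cmSet]

/-- The run of `(Q,T)` visits a configuration `(s,(y,z))` iff
the matched run of the flag machine `(Q',T')` visits `(s_{ab},(y,z))` where the
flags `a`, `b` record positivity of `y`, `z`.  In particular, the run of `(Q,T)`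
reaches a configuration in `Q × {(0,0)}` iff the matched run of `(Q',T')`
reaches a configuration in `Q' × {(0,0)}`. -/
theorem flag_machine_simulation (M : TwoCM) (hdet : CMDeterministic M) :
    (∀ s y z : ℕ,
        Relation.ReflTransGen (CMStep M) cmInit (s, y, z) ↔
          Relation.ReflTransGen (FlagStep M) flagInit
            ((s, decide (0 < y), decide (0 < z)), y, z)) ∧
    ((∃ s : ℕ, Relation.ReflTransGen (CMStep M) cmInit (s, 0, 0)) ↔
      (∃ q : FState, Relation.ReflTransGen (FlagStep M) flagInit (q, 0, 0))) := by
  have to_flag {c c' : ℕ × ℕ × ℕ} (h : Relation.ReflTransGen (CMStep M) c c') :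
      Relation.ReflTransGen (FlagStep M) (withFlags c) (withFlags c') :=
    h.lift withFlags fun _ _ => CMStep.withFlags fun t ht => (hdet.1 t ht).1
  have of_flag {c c' : FState × ℕ × ℕ} (h : Relation.ReflTransGen (FlagStep M) c c') :
      Relation.ReflTransGen (CMStep M) (forgetFlags c) (forgetFlags c') :=
    h.lift forgetFlags fun _ _ => FlagStep.forgetFlags
  exact ⟨fun s y z => ⟨to_flag, of_flag⟩,
    fun ⟨s, h⟩ => ⟨_, to_flag h⟩, fun ⟨q, h⟩ => ⟨q.1, of_flag h⟩⟩
end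

section
/- In the robot game with states G(Q,T), suppose that so far Eve has played only correct simulating moves and Adam has played only the 0-move (0,0), and then Adam plays the positivity check (1,0) for the first time, producing a configuration (s_{ab},(4x+1,y)) in which both flags match the values x and y. Then Eve has a winning strategy from this configuration (Eve to move), starting with the connecting move (s_{ab},(−1,0),⊤_{ab}). -/
/-- A configuration of a robot game with states: a control state of Eve together
with the two integer counters. -/
abbrev RGSConf (S : Type) : Type := S × ℤ × ℤ

/-- A move of Eve in a robot game with states: source state, vector, target state. -/
abbrev RGSEMove (S : Type) : Type := S × (ℤ × ℤ) × S

/-- A history of a play: the rounds played so far, each round consisting of Adam's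
vector followed by Eve's move. -/
abbrev RGSHist (S : Type) : Type := List ((ℤ × ℤ) × RGSEMove S)

/-- A strategy of Eve: a function from histories and Adam's current vector to a move. -/
abbrev RGSEStrat (S : Type) : Type := RGSHist S → (ℤ × ℤ) → RGSEMove S

/-- A strategy of Adam: a function from histories to a vector. -/
abbrev RGSAStrat (S : Type) : Type := RGSHist S → ℤ × ℤ

/-- The configuration reached from `c0` after playing the history `h`. -/
def rgsConfAfter {S : Type} (c0 : RGSConf S) (h : RGSHist S) : RGSConf S :=
  h.foldl (fun c mv => (mv.2.2.2, c.2 + mv.1 + mv.2.2.1)) c0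

/-- The history of the first `k` rounds when Eve plays `σ` and Adam plays `τ`. -/
def rgsPlay {S : Type} (σ : RGSEStrat S) (τ : RGSAStrat S) : ℕ → RGSHist S
  | 0 => []
  | k + 1 =>
      rgsPlay σ τ k ++
        [(τ (rgsPlay σ τ k), σ (rgsPlay σ τ k) (τ (rgsPlay σ τ k)))]

/-- Eve's move in round `k` is legal: it belongs to `E` and its source state is
the current control state. -/
def RGSEveLegal {S : Type} (E : Set (RGSEMove S)) (c0 : RGSConf S)
    (σ : RGSEStrat S) (τ : RGSAStrat S) (k : ℕ) : Prop :=
  σ (rgsPlay σ τ k) (τ (rgsPlay σ τ k)) ∈ E ∧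
    (σ (rgsPlay σ τ k) (τ (rgsPlay σ τ k))).1 = (rgsConfAfter c0 (rgsPlay σ τ k)).1

/-- The play of `σ` against `τ` from `c0` is won by Eve: at some round Eve has
played legally so far and the counters are `(0, 0)` after her move. -/
def RGSEveWinsPlay {S : Type} (E : Set (RGSEMove S)) (c0 : RGSConf S)
    (σ : RGSEStrat S) (τ : RGSAStrat S) : Prop :=
  ∃ k, (∀ j ≤ k, RGSEveLegal E c0 σ τ j) ∧
    (rgsConfAfter c0 (rgsPlay σ τ (k + 1))).2 = 0

/-- Eve has a winning strategy from configuration `c0` (Adam to move): she has a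
strategy such that every play consistent with it is won by her. -/
def RGSEveWins {S : Type} (E : Set (RGSEMove S)) (A : Set (ℤ × ℤ))
    (c0 : RGSConf S) : Prop :=
  ∃ σ : RGSEStrat S, ∀ τ : RGSAStrat S,
    (∀ k, τ (rgsPlay σ τ k) ∈ A) → RGSEveWinsPlay E c0 σ τ

/-- Adam has a winning strategy from configuration `c0` (Adam to move): he has a
(legal) strategy such that no play consistent with it is won by Eve. -/
def RGSAdamWins {S : Type} (E : Set (RGSEMove S)) (A : Set (ℤ × ℤ))
    (c0 : RGSConf S) : Prop :=
  ∃ τ : RGSAStrat S, (∀ σ k, τ (rgsPlay σ τ k) ∈ A) ∧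
    ∀ σ, ¬ RGSEveWinsPlay E c0 σ τ

/-- A control state of Eve in the game `G(Q,T)`: a flagged machine state (`inl`)
or one of the four emptying states `⊤ab` (`inr`). -/
abbrev GState : Type := FState ⊕ (Bool × Bool)

/-- The vector of Eve's simulating move for the label `(i, op)`: increments and
decrements of the first counter are multiplied by `4`. -/
def simVec (i op : ℕ) : ℤ × ℤ :=
  if op = 0 then (if i = 0 then (4, 0) else (0, 1))
  else if op = 1 then (if i = 0 then (-4, 0) else (0, -1))
  else (0, 0)

/-- Eve's moves in the robot game with states `G(Q,T)`: the simulating moves, the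
connecting moves `(s_ab, (-1,0), ⊤_ab)`, and the emptying moves. -/
def gameE (M : TwoCM) : Set (RGSEMove GState) :=
  { m | (∃ p i op q, FlagTrans M p i op q ∧ m = (Sum.inl p, simVec i op, Sum.inl q)) ∨
        (∃ s a b, s ∈ cmStates M ∧
          m = (Sum.inl (s, a, b), ((-1 : ℤ), (0 : ℤ)), Sum.inr (a, b))) ∨
        (∃ e : ℤ, (e = 0 ∨ e = 1) ∧
          ((∃ t : Bool × Bool, m = (Sum.inr (true, true), (-4 - e, -1), Sum.inr t)) ∨
           (∃ t : Bool × Bool, (t = (true, false) ∨ t = (false, false)) ∧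
             m = (Sum.inr (true, false), (-4 - e, 0), Sum.inr t)) ∨
           (∃ t : Bool × Bool, (t = (false, true) ∨ t = (false, false)) ∧
             m = (Sum.inr (false, true), (-e, -1), Sum.inr t)) ∨
           m = (Sum.inr (false, false), (-e, 0), Sum.inr (false, false)))) }

/-- Adam's moves in `G(Q,T)`: the 0-move `(0,0)` and the positivity check `(1,0)`. -/
def gameA : Set (ℤ × ℤ) := {((0 : ℤ), (0 : ℤ)), ((1 : ℤ), (0 : ℤ))}

/-- The game configuration encoding a configuration of the flag machine: the
first counter is multiplied by `4`. -/
def encodeConf (c : FState × ℕ × ℕ) : RGSConf GState :=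
  (Sum.inl c.1, (4 * (c.2.1 : ℤ), (c.2.2 : ℤ)))

/-- The positivity flags matching the pair of counter values `c`. -/
def flagsOf (c : ℕ × ℕ) : Bool × Bool := (decide (0 < c.1), decide (0 < c.2))

/-- The configuration with emptying state matching `c` and counters `(4 * c.1, c.2)`. -/
def emptyingConf (c : ℕ × ℕ) : RGSConf GState :=
  (Sum.inr (flagsOf c), (4 * (c.1 : ℤ), (c.2 : ℤ)))

/-- Eve's emptying move from `emptyingConf c` that cancels Adam's vector `v` and decreases
every positive counter by one unit. -/
def emptyingMove (c : ℕ × ℕ) (v : ℤ × ℤ) : RGSEMove GState :=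
  (Sum.inr (flagsOf c),
    ((if 0 < c.1 then -4 else 0) - v.1, if 0 < c.2 then -1 else 0),
    Sum.inr (flagsOf (c - 1)))

/-- Eve's strategy that empties the counters from `emptyingConf c`. -/
def emptyingStrat (c : ℕ × ℕ) : RGSEStrat GState :=
  fun h v => emptyingMove (c.1 - h.length, c.2 - h.length) v

theorem rgsPlay_length {S : Type} (σ : RGSEStrat S) (τ : RGSAStrat S) (k : ℕ) :
    (rgsPlay σ τ k).length = k := by
  induction k with
  | zero => rfl
  | succ k ih => simp [rgsPlay, ih]

theorem rgsConfAfter_play_succ {S : Type} (c0 : RGSConf S) (σ : RGSEStrat S)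
    (τ : RGSAStrat S) (k : ℕ) :
    rgsConfAfter c0 (rgsPlay σ τ (k + 1)) =
      ((σ (rgsPlay σ τ k) (τ (rgsPlay σ τ k))).2.2,
        (rgsConfAfter c0 (rgsPlay σ τ k)).2 + τ (rgsPlay σ τ k) +
          (σ (rgsPlay σ τ k) (τ (rgsPlay σ τ k))).2.1) := by
  simp [rgsPlay, rgsConfAfter]

theorem emptyingMove_mem_gameE (M : TwoCM) (c : ℕ × ℕ) {v : ℤ × ℤ} (hv : v ∈ gameA) :
    emptyingMove c v ∈ gameE M := by
  obtain ⟨x, y⟩ := c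
  refine Or.inr (Or.inr ⟨v.1, ?_, ?_⟩)
  · rcases hv with rfl | rfl <;> simp
  · rcases Nat.eq_zero_or_pos x with rfl | hx <;> rcases Nat.eq_zero_or_pos y with rfl | hy
    · simp [emptyingMove, flagsOf]
    · refine Or.inr (Or.inr (Or.inl ⟨flagsOf ((0, y) - 1), ?_, ?_⟩))
      · by_cases h : 1 < y <;> simp [flagsOf, h]
      · simp [emptyingMove, flagsOf, hy]
    · refine Or.inr (Or.inl ⟨flagsOf ((x, 0) - 1), ?_, ?_⟩)
      · by_cases h : 1 < x <;> simp [flagsOf, h]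
      · simp [emptyingMove, flagsOf, hx]
    · exact Or.inl ⟨flagsOf ((x, y) - 1), by simp [emptyingMove, flagsOf, hx, hy]⟩

theorem emptyingMove_counters (c : ℕ × ℕ) {v : ℤ × ℤ} (hv : v ∈ gameA) :
    (emptyingConf c).2 + v + (emptyingMove c v).2.1 = (emptyingConf (c - 1)).2 := by
  obtain ⟨x, y⟩ := c
  have hv2 : v.2 = 0 := by rcases hv with rfl | rfl <;> rfl
  ext
  · simp only [emptyingConf, emptyingMove, Prod.fst_add, Prod.fst_sub, Prod.fst_one]
    split_ifs <;> omega
  · simp only [emptyingConf, emptyingMove, Prod.snd_add, Prod.snd_sub, Prod.snd_one, hv2]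
    split_ifs <;> omega

theorem rgsConfAfter_emptyingStrat (c : ℕ × ℕ) (τ : RGSAStrat GState)
    (hτ : ∀ k, τ (rgsPlay (emptyingStrat c) τ k) ∈ gameA) (k : ℕ) :
    rgsConfAfter (emptyingConf c) (rgsPlay (emptyingStrat c) τ k) =
      emptyingConf (c.1 - k, c.2 - k) := by
  induction k with
  | zero => rfl
  | succ k ih =>
    rw [rgsConfAfter_play_succ, ih]
    simp only [emptyingStrat, rgsPlay_length]
    rw [emptyingMove_counters _ (hτ k)]
    rfl

/-- Eve wins from every emptying state whose flags match the counters. -/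
theorem eveWins_emptyingConf (M : TwoCM) (c : ℕ × ℕ) :
    RGSEveWins (gameE M) gameA (emptyingConf c) := by
  refine ⟨emptyingStrat c, fun τ hτ => ⟨max c.1 c.2, fun j _ => ⟨?_, ?_⟩, ?_⟩⟩
  · exact emptyingMove_mem_gameE M _ (hτ j)
  · rw [rgsConfAfter_emptyingStrat c τ hτ]
    simp only [emptyingStrat, rgsPlay_length]
    rfl
  · rw [rgsConfAfter_emptyingStrat c τ hτ]
    have h₁ : c.1 - (max c.1 c.2 + 1) = 0 := by omega
    have h₂ : c.2 - (max c.1 c.2 + 1) = 0 := by omega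
    rw [h₁, h₂]
    rfl

/-- In the game `G(Q,T)`, if Eve has played only correct
simulating moves and Adam then plays the positivity check `(1,0)` for the first
time, producing a configuration `(s_ab, (4x+1, y))` in which both flags match
the values `x` and `y`, then Eve has a winning strategy from this configuration
(Eve to move), starting with the connecting move `(s_ab, (-1,0), ⊤_ab)`: the
connecting move is legal and after playing it Eve has either already won or has
a winning strategy with Adam to move. -/
theorem eve_wins_after_positivity_check (M : TwoCM) (hdet : CMDeterministic M)
    (s : ℕ) (hs : s ∈ cmStates M) (x y : ℕ) (a b : Bool)
    (ha : a = decide (0 < x)) (hb : b = decide (0 < y)) :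
    (Sum.inl (s, a, b), ((-1 : ℤ), (0 : ℤ)), Sum.inr (a, b)) ∈ gameE M ∧
      ((((4 * (x : ℤ), (y : ℤ)) : ℤ × ℤ) = 0) ∨
        RGSEveWins (gameE M) gameA (Sum.inr (a, b), (4 * (x : ℤ), (y : ℤ)))) := by
  subst ha hb
  exact ⟨Or.inr (Or.inl ⟨s, _, _, hs, rfl⟩), Or.inr (eveWins_emptyingConf M (x, y))⟩
end
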